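/- arXiv:1307.2794 — 3 statements merged into one kernel-verified Lean document; each statement's English description precedes it below -/
import Mathlib

section
/- Let $\Omega \subseteq \mathbb{R}^N$ have finite measure, $p : \Omega \to (1,\infty)$ measurable with $1 < p^- \leq p^+ < \infty$, $V = L^{p(x)}(\Omega)$. The operator $Z_\Omega : V \to V^*$, $(Z_\Omega v)(x) := |v(x)|^{p(x)-2}v(x)$ is strictly monotone, bounded, continuous, and coercive; in particular, for any maximal monotone operator $A \subseteq V \times V^*$, $A + \lambda Z_\Omega$ is surjective for every $\lambda > 0$. -/
open MeasureTheory Filter Set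
open scoped ENNReal Topology

noncomputable section

/-- The modular of a variable exponent Lebesgue space. -/
def vModular {α : Type*} [MeasurableSpace α] (μ : Measure α) (p : α → ℝ) (u : α → ℝ) : ℝ≥0∞ :=
  ∫⁻ x, ENNReal.ofReal (|u x| ^ p x) ∂μ

/-- Membership in the variable exponent Lebesgue space `L^{p(x)}`. -/
def MemVLp {α : Type*} [MeasurableSpace α] (μ : Measure α) (p : α → ℝ) (u : α → ℝ) : Prop :=
  AEMeasurable u μ ∧ vModular μ p u < ⊤

/-- The Luxemburg norm on the variable exponent Lebesgue space. -/
def luxNorm {α : Type*} [MeasurableSpace α] (μ : Measure α) (p : α → ℝ) (u : α → ℝ) : ℝ :=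
  sInf {lam : ℝ | 0 < lam ∧ vModular μ p (fun x => u x / lam) ≤ 1}

/-- The operator `Z : u ↦ |u|^{p(x)-2}u`. -/
def zOp {α : Type*} (p : α → ℝ) (w : α → ℝ) : α → ℝ := fun x => |w x| ^ (p x - 2) * w x

/-- scalar version of the operator -/
def zf (p a : ℝ) : ℝ := |a| ^ (p - 2) * a

lemma HC (m M : ℝ) (h1 : 1 < m) (f g : ℝ → ℝ → ℝ → ℝ)
    (hf : ContinuousOn (fun q : ℝ × ℝ × ℝ => f q.1 q.2.1 q.2.2) (Icc m M ×ˢ univ))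
    (hg : ContinuousOn (fun q : ℝ × ℝ × ℝ => g q.1 q.2.1 q.2.2) (Icc m M ×ˢ univ))
    (hf0 : ∀ p ∈ Icc m M, f p 0 0 ≤ 0)
    (hg0 : ∀ p ∈ Icc m M, ∀ a b, 0 ≤ g p a b)
    (hfg : ∀ p ∈ Icc m M, ∀ a b, g p a b = 0 → f p a b ≤ 0)
    (hfs : ∀ p ∈ Icc m M, ∀ s > 0, ∀ a b, f p (s * a) (s * b) = s ^ p * f p a b)
    (hgs : ∀ p ∈ Icc m M, ∀ s > 0, ∀ a b, g p (s * a) (s * b) = s ^ p * g p a b)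
    (ε : ℝ) (hε : 0 < ε) :
    ∃ C : ℝ, 0 ≤ C ∧ ∀ p ∈ Icc m M, ∀ a b, f p a b ≤ ε * (|a| ^ p + |b| ^ p) + C * g p a b := by
  set T : Set (ℝ × ℝ × ℝ) := Icc m M ×ˢ ((Icc (-1) 1 ×ˢ Icc (-1) 1) ∩ {q | |q.1| + |q.2| = 1})
    with hT
  have hTc : IsCompact T := by
    refine isCompact_Icc.prod ((isCompact_Icc.prod isCompact_Icc).inter_right ?_)
    exact isClosed_eq (by fun_prop) (by fun_prop)
  have hTs : T ⊆ Icc m M ×ˢ univ := fun q hq => ⟨hq.1, trivial⟩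
  have hN : ContinuousOn (fun q : ℝ × ℝ × ℝ => ε * (|q.2.1| ^ q.1 + |q.2.2| ^ q.1)) T := by
    refine continuousOn_const.mul (ContinuousOn.add ?_ ?_)
    · refine ContinuousOn.rpow (by fun_prop) (by fun_prop) (fun q hq => Or.inr ?_)
      have := hq.1.1; linarith
    · refine ContinuousOn.rpow (by fun_prop) (by fun_prop) (fun q hq => Or.inr ?_)
      have := hq.1.1; linarith
  obtain ⟨F, hF⟩ := (hTc.image_of_continuousOn (hf.mono hTs)).bddAbove
  have hF' : ∀ q ∈ T, f q.1 q.2.1 q.2.2 ≤ F := fun q hq => hF ⟨q, hq, rfl⟩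
  set S : Set (ℝ × ℝ × ℝ) := T ∩
    (fun q : ℝ × ℝ × ℝ => f q.1 q.2.1 q.2.2 - ε * (|q.2.1| ^ q.1 + |q.2.2| ^ q.1)) ⁻¹' (Ici 0)
  have hSc : IsCompact S := by
    refine hTc.of_isClosed_subset ?_ inter_subset_left
    exact ContinuousOn.preimage_isClosed_of_isClosed ((hf.mono hTs).sub hN) hTc.isClosed isClosed_Ici
  have key : ∃ C : ℝ, 0 ≤ C ∧ ∀ q ∈ T, f q.1 q.2.1 q.2.2 ≤
      ε * (|q.2.1| ^ q.1 + |q.2.2| ^ q.1) + C * g q.1 q.2.1 q.2.2 := by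
    rcases S.eq_empty_or_nonempty with hS | hS
    · refine ⟨0, le_rfl, fun q hq => ?_⟩
      by_contra hcon
      have : q ∈ S := ⟨hq, by simp only [mem_preimage, mem_Ici]; linarith⟩
      rw [hS] at this; exact this
    · obtain ⟨q0, hq0, hmin⟩ := hSc.exists_isMinOn hS ((hg.mono hTs).mono inter_subset_left)
      have hpos : 0 < g q0.1 q0.2.1 q0.2.2 := by
        rcases (hg0 q0.1 hq0.1.1 q0.2.1 q0.2.2).lt_or_eq with h | h
        · exact h
        · exfalso
          have h2 := hfg q0.1 hq0.1.1 _ _ h.symm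
          have h3 : 0 ≤ f q0.1 q0.2.1 q0.2.2 - ε * (|q0.2.1| ^ q0.1 + |q0.2.2| ^ q0.1) := hq0.2
          have h4 : |q0.2.1| + |q0.2.2| = 1 := hq0.1.2.2
          have h5 : 0 < |q0.2.1| ^ q0.1 + |q0.2.2| ^ q0.1 := by
            by_cases h6 : q0.2.1 = 0
            · have : 0 < |q0.2.2| := by rw [h6, abs_zero] at h4; linarith
              positivity
            · have : 0 < |q0.2.1| := abs_pos.2 h6
              positivity
          nlinarith [mul_pos hε h5]
      refine ⟨max F 0 / g q0.1 q0.2.1 q0.2.2, by positivity, fun q hq => ?_⟩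
      by_cases hqS : q ∈ S
      · have h2 : g q0.1 q0.2.1 q0.2.2 ≤ g q.1 q.2.1 q.2.2 := hmin hqS
        have h3 : max F 0 ≤ max F 0 / g q0.1 q0.2.1 q0.2.2 * g q.1 q.2.1 q.2.2 := by
          rw [div_mul_eq_mul_div, le_div_iff₀ hpos]
          exact mul_le_mul_of_nonneg_left h2 (le_max_right _ _)
        have h4 := (hF' q hq).trans (le_max_left F 0)
        have : 0 ≤ ε * (|q.2.1| ^ q.1 + |q.2.2| ^ q.1) := by positivity
        linarith
      · have : f q.1 q.2.1 q.2.2 ≤ ε * (|q.2.1| ^ q.1 + |q.2.2| ^ q.1) := by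
          by_contra hcon
          exact hqS ⟨hq, by simp only [mem_preimage, mem_Ici]; linarith⟩
        have h5 := hg0 q.1 hq.1 q.2.1 q.2.2
        have : 0 ≤ max F 0 / g q0.1 q0.2.1 q0.2.2 * g q.1 q.2.1 q.2.2 := by positivity
        linarith
  obtain ⟨C, hC, hkey⟩ := key
  refine ⟨C, hC, fun p hp a b => ?_⟩
  by_cases hs : |a| + |b| = 0
  · have ha : a = 0 := abs_eq_zero.1 (by linarith [abs_nonneg a, abs_nonneg b])
    have hb : b = 0 := abs_eq_zero.1 (by linarith [abs_nonneg a, abs_nonneg b])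
    subst ha; subst hb
    have h2 := hf0 p hp
    have h3 := hg0 p hp 0 0
    have : 0 ≤ ε * (|(0:ℝ)| ^ p + |(0:ℝ)| ^ p) + C * g p 0 0 := by positivity
    linarith
  · have hs' : 0 < |a| + |b| := lt_of_le_of_ne (by positivity) (Ne.symm hs)
    set s := |a| + |b| with hsdef
    have ea : a = s * (a / s) := by field_simp
    have eb : b = s * (b / s) := by field_simp
    have h4 : |a / s| + |b / s| = 1 := by
      rw [abs_div, abs_div, abs_of_pos hs', ← add_div, ← hsdef, div_self hs]
    have hq : (p, a / s, b / s) ∈ T := by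
      refine ⟨hp, ⟨⟨abs_le.1 ?_, abs_le.1 ?_⟩, h4⟩⟩
      · show |a / s| ≤ 1
        linarith [abs_nonneg (b / s)]
      · show |b / s| ≤ 1
        linarith [abs_nonneg (a / s)]
    have h5 := hkey _ hq
    simp only at h5
    have h6 : f p a b = s ^ p * f p (a / s) (b / s) := by
      rw [← hfs p hp s hs', ← ea, ← eb]
    have h7 : g p a b = s ^ p * g p (a / s) (b / s) := by
      rw [← hgs p hp s hs', ← ea, ← eb]
    have h8 : |a| ^ p = s ^ p * |a / s| ^ p := by
      rw [← Real.mul_rpow hs'.le (abs_nonneg _), abs_div, abs_of_pos hs']; congr 1; field_simp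
    have h9 : |b| ^ p = s ^ p * |b / s| ^ p := by
      rw [← Real.mul_rpow hs'.le (abs_nonneg _), abs_div, abs_of_pos hs']; congr 1; field_simp
    rw [h6, h7, h8, h9]
    have := mul_le_mul_of_nonneg_left h5 (Real.rpow_nonneg hs'.le p)
    linarith

lemma cont_abs_rpow {m M : ℝ} (h1 : 1 < m) (l : ℝ × ℝ × ℝ → ℝ) (hl : Continuous l) :
    ContinuousOn (fun q : ℝ × ℝ × ℝ => |l q| ^ q.1) (Icc m M ×ˢ univ) := by
  refine ContinuousOn.rpow (by fun_prop) (by fun_prop) (fun q hq => Or.inr ?_)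
  have := hq.1.1; linarith

lemma abs_scale {p s : ℝ} (hs : 0 < s) (c : ℝ) : |s * c| ^ p = s ^ p * |c| ^ p := by
  rw [abs_mul, abs_of_pos hs, Real.mul_rpow hs.le (abs_nonneg _)]

lemma zf_zero (p : ℝ) : zf p 0 = 0 := by simp [zf]

lemma zf_neg (p a : ℝ) : zf p (-a) = - zf p a := by simp [zf]

lemma zf_of_nonneg {p a : ℝ} (hp : 1 < p) (ha : 0 ≤ a) : zf p a = a ^ (p - 1) := by
  rcases ha.lt_or_eq with h | h
  · rw [zf, abs_of_pos h]
    nth_rewrite 2 [← Real.rpow_one a]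
    rw [← Real.rpow_add h]; congr 1; ring
  · subst h; rw [zf_zero, Real.zero_rpow (by linarith)]

lemma zf_eq {p a : ℝ} (hp : 1 < p) : zf p a = (max a 0) ^ (p - 1) - (max (-a) 0) ^ (p - 1) := by
  have h0 : (0:ℝ) ^ (p - 1) = 0 := Real.zero_rpow (by linarith)
  rcases le_total 0 a with h | h
  · rw [zf_of_nonneg hp h, max_eq_left h, max_eq_right (by linarith), h0, sub_zero]
  · rw [max_eq_right h, max_eq_left (by linarith), h0, ← zf_of_nonneg hp (by linarith), zf_neg]; ring

lemma abs_zf {p a : ℝ} (hp : 1 < p) : |zf p a| = |a| ^ (p - 1) := by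
  rcases le_total 0 a with h | h
  · rw [zf_of_nonneg hp h, abs_of_nonneg h, abs_of_nonneg (by positivity)]
  · have : zf p a = - zf p (-a) := by rw [zf_neg]; ring
    rw [this, abs_neg, zf_of_nonneg hp (by linarith), abs_of_nonpos h,
      abs_of_nonneg (Real.rpow_nonneg (by linarith) _)]

lemma zf_strictMono {p : ℝ} (hp : 1 < p) : StrictMono (zf p) := by
  apply strictMono_of_odd_strictMonoOn_nonneg (fun a => zf_neg p a)
  intro a ha b hb hab
  simp only [mem_Ici] at ha hb
  rw [zf_of_nonneg hp ha, zf_of_nonneg hp hb]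
  exact Real.rpow_lt_rpow ha hab (by linarith)

lemma zf_mul_self {p a : ℝ} (hp : 1 < p) : zf p a * a = |a| ^ p := by
  have h : zf p a * a = |zf p a| * |a| := by
    rw [← abs_mul, abs_of_nonneg]
    rw [zf, mul_assoc]
    exact mul_nonneg (by positivity) (mul_self_nonneg a)
  rw [h, abs_zf hp]
  rcases (abs_nonneg a).lt_or_eq with h | h
  · nth_rewrite 2 [← Real.rpow_one |a|]
    rw [← Real.rpow_add h]; congr 1; ring
  · rw [← h, mul_zero, Real.zero_rpow (by linarith)]

lemma abs_zf_rpow {p q a : ℝ} (h : p.HolderConjugate q) : |zf p a| ^ q = |a| ^ p := by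
  rw [abs_zf h.lt, ← Real.rpow_mul (abs_nonneg _), h.sub_one_mul_conj]

lemma zf_inv {p q a : ℝ} (h : p.HolderConjugate q) : zf p (zf q a) = a := by
  wlog ha : 0 ≤ a
  · have := this h (a := -a) (by linarith)
    rw [zf_neg, zf_neg] at this; linarith
  have h2 : 0 ≤ a ^ (q - 1) := by positivity
  rw [zf_of_nonneg h.symm.lt ha, zf_of_nonneg h.lt h2, ← Real.rpow_mul ha]
  have : (q - 1) * (p - 1) = 1 := by
    have := h.mul_eq_add; nlinarith
  rw [this, Real.rpow_one]

lemma zf_scale {p s : ℝ} (hs : 0 < s) (hp : 1 < p) (a : ℝ) : zf p (s * a) = s ^ (p - 1) * zf p a := by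
  have h0 : s ^ (p - 1) = s ^ (p - 2) * s := by
    nth_rewrite 3 [← Real.rpow_one s]
    rw [← Real.rpow_add hs]; congr 1; ring
  rw [zf, zf, abs_scale hs, h0]; ring

lemma cont_zf {m M : ℝ} (h1 : 1 < m) (l : ℝ × ℝ × ℝ → ℝ) (hl : Continuous l) :
    ContinuousOn (fun q : ℝ × ℝ × ℝ => zf q.1 (l q)) (Icc m M ×ˢ univ) := by
  have : ContinuousOn (fun q : ℝ × ℝ × ℝ => (max (l q) 0) ^ (q.1 - 1) - (max (-l q) 0) ^ (q.1 - 1))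
      (Icc m M ×ˢ univ) := by
    refine ContinuousOn.sub ?_ ?_ <;>
    · refine ContinuousOn.rpow (by fun_prop) (by fun_prop) (fun q hq => Or.inr ?_)
      have := hq.1.1; linarith
  refine this.congr fun q hq => zf_eq ?_
  have := hq.1.1; linarith

/-- convexity defect -/
def dfc (p a b : ℝ) : ℝ := (|a| ^ p / p + |b| ^ p / p) / 2 - |(1 / 2) * (a + b)| ^ p / p

lemma dfc_pos {p a b : ℝ} (hp : 1 < p) (hab : a ≠ b) : 0 < dfc p a b := by
  have hp0 : 0 < p := by linarith
  have key : |(1 / 2) * (a + b)| ^ p < (|a| ^ p + |b| ^ p) / 2 := by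
    by_cases h : |a| = |b|
    · have h2 : a = -b := (abs_eq_abs.1 h).resolve_left hab
      have hb : b ≠ 0 := by rintro rfl; simp at h2; exact hab h2
      have : 0 < |b| := abs_pos.2 hb
      subst h2
      simp only [neg_add_cancel, mul_zero, abs_zero, abs_neg]
      rw [Real.zero_rpow hp0.ne']
      positivity
    · have h3 := (strictConvexOn_rpow hp).2 (abs_nonneg a : |a| ∈ Ici (0:ℝ)) (abs_nonneg b : |b| ∈ Ici (0:ℝ)) h
        (by norm_num : (0:ℝ) < 1/2) (by norm_num : (0:ℝ) < 1/2) (by norm_num)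
      simp only [smul_eq_mul] at h3
      have h4 : |(1 / 2) * (a + b)| ≤ 1 / 2 * |a| + 1 / 2 * |b| := by
        rw [abs_mul, abs_of_pos (by norm_num : (0:ℝ) < 1/2)]
        linarith [abs_add_le a b]
      have h5 := Real.rpow_le_rpow (abs_nonneg _) h4 hp0.le
      linarith
  have : dfc p a b = ((|a| ^ p + |b| ^ p) / 2 - |(1 / 2) * (a + b)| ^ p) / p := by
    rw [dfc]; ring
  rw [this]; apply div_pos _ hp0; linarith

lemma dfc_nonneg {p : ℝ} (hp : 1 < p) (a b : ℝ) : 0 ≤ dfc p a b := by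
  by_cases hab : a = b
  · subst hab
    rw [dfc, ← two_mul a, ← mul_assoc]; norm_num
  · exact (dfc_pos hp hab).le

lemma est_uc {m M : ℝ} (h1 : 1 < m) {ε : ℝ} (hε : 0 < ε) : ∃ C : ℝ, 0 ≤ C ∧ ∀ p ∈ Icc m M, ∀ a b,
    |a - b| ^ p ≤ ε * (|a| ^ p + |b| ^ p) + C * dfc p a b := by
  have hpos : ∀ p ∈ Icc m M, 1 < p := fun p hp => h1.trans_le hp.1
  refine HC m M h1 (fun p a b => |a - b| ^ p) dfc ?_ ?_ ?_ ?_ ?_ ?_ ?_ ε hε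
  · exact cont_abs_rpow h1 (fun q => q.2.1 - q.2.2) (by fun_prop)
  · unfold dfc
    have hne : ∀ q ∈ (Icc m M ×ˢ univ : Set (ℝ × ℝ × ℝ)), q.1 ≠ 0 := fun q hq => by
      have := hpos q.1 hq.1; linarith
    have e := continuousOn_fst (α := ℝ) (β := ℝ × ℝ) (s := (Icc m M ×ˢ univ : Set (ℝ × ℝ × ℝ)))
    exact ((((cont_abs_rpow h1 (fun q => q.2.1) (by fun_prop)).div e hne).add
      ((cont_abs_rpow h1 (fun q => q.2.2) (by fun_prop)).div e hne)).div_const 2).sub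
      ((cont_abs_rpow h1 (fun q => (1/2) * (q.2.1 + q.2.2)) (by fun_prop)).div e hne)
  · intro p hp
    have := hpos p hp
    simp only [sub_self, abs_zero]
    rw [Real.zero_rpow (by linarith)]
  · intro p hp a b
    exact dfc_nonneg (hpos p hp) a b
  · intro p hp a b h
    have := hpos p hp
    by_cases hab : a = b
    · subst hab; simp only [sub_self, abs_zero]; rw [Real.zero_rpow (by linarith)]
    · exact absurd h (dfc_pos this hab).ne'
  · intro p hp s hs a b
    rw [← mul_sub, abs_scale hs]
  · intro p hp s hs a b
    unfold dfc
    have : 1 / 2 * (s * a + s * b) = s * (1 / 2 * (a + b)) := by ring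
    rw [this, abs_scale hs, abs_scale hs, abs_scale hs]; ring

lemma sub_zero_of {p a b : ℝ} (hp : 1 < p) (h : |a - b| ^ p = 0) : a = b := by
  rw [Real.rpow_eq_zero (abs_nonneg _) (by linarith), abs_eq_zero] at h
  linarith

lemma est_z {m M : ℝ} (h1 : 1 < m) {ε : ℝ} (hε : 0 < ε) : ∃ C : ℝ, 0 ≤ C ∧ ∀ p ∈ Icc m M, ∀ a b,
    |zf p a - zf p b| ^ (p / (p - 1)) ≤ ε * (|a| ^ p + |b| ^ p) + C * |a - b| ^ p := by
  have hpos : ∀ p ∈ Icc m M, 1 < p := fun p hp => h1.trans_le hp.1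
  have hq : ∀ p ∈ Icc m M, 0 < p / (p - 1) := fun p hp => by
    have := hpos p hp
    exact div_pos (by linarith) (by linarith)
  refine HC m M h1 (fun p a b => |zf p a - zf p b| ^ (p / (p - 1))) (fun p a b => |a - b| ^ p)
    ?_ ?_ ?_ ?_ ?_ ?_ ?_ ε hε
  · refine ContinuousOn.rpow ?_ ?_ (fun q h => Or.inr (hq q.1 h.1))
    · exact ((cont_zf h1 (fun q => q.2.1) (by fun_prop)).sub
        (cont_zf h1 (fun q => q.2.2) (by fun_prop))).abs
    · refine ContinuousOn.div (by fun_prop) (by fun_prop) (fun q h => ?_)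
      have := hpos q.1 h.1; linarith
  · exact cont_abs_rpow h1 (fun q => q.2.1 - q.2.2) (by fun_prop)
  · intro p hp
    simp only [sub_self, abs_zero]
    rw [Real.zero_rpow (hq p hp).ne']
  · intro p hp a b; positivity
  · intro p hp a b h
    have := sub_zero_of (hpos p hp) h
    subst this
    simp only [sub_self, abs_zero]
    rw [Real.zero_rpow (hq p hp).ne']
  · intro p hp s hs a b
    have := hpos p hp
    rw [zf_scale hs this, zf_scale hs this, ← mul_sub, abs_scale (by positivity), ← Real.rpow_mul hs.le]
    congr 2
    field_simp [show p - 1 ≠ 0 by linarith]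
  · intro p hp s hs a b
    rw [← mul_sub, abs_scale hs]

lemma est_phi {m M : ℝ} (h1 : 1 < m) {ε : ℝ} (hε : 0 < ε) : ∃ C : ℝ, 0 ≤ C ∧ ∀ p ∈ Icc m M, ∀ a b,
    |(|a| ^ p / p - |b| ^ p / p)| ≤ ε * (|a| ^ p + |b| ^ p) + C * |a - b| ^ p := by
  have hpos : ∀ p ∈ Icc m M, 1 < p := fun p hp => h1.trans_le hp.1
  refine HC m M h1 (fun p a b => |(|a| ^ p / p - |b| ^ p / p)|) (fun p a b => |a - b| ^ p)
    ?_ ?_ ?_ ?_ ?_ ?_ ?_ ε hε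
  · have hne : ∀ q ∈ (Icc m M ×ˢ univ : Set (ℝ × ℝ × ℝ)), q.1 ≠ 0 := fun q hq => by
      have := hpos q.1 hq.1; linarith
    have e := continuousOn_fst (α := ℝ) (β := ℝ × ℝ) (s := (Icc m M ×ˢ univ : Set (ℝ × ℝ × ℝ)))
    exact (((cont_abs_rpow h1 (fun q => q.2.1) (by fun_prop)).div e hne).sub
      ((cont_abs_rpow h1 (fun q => q.2.2) (by fun_prop)).div e hne)).abs
  · exact cont_abs_rpow h1 (fun q => q.2.1 - q.2.2) (by fun_prop)
  · intro p hp
    simp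
  · intro p hp a b; positivity
  · intro p hp a b h
    have := sub_zero_of (hpos p hp) h
    subst this
    simp
  · intro p hp s hs a b
    rw [abs_scale hs, abs_scale hs, mul_div_assoc, mul_div_assoc, ← mul_sub, abs_mul,
      abs_of_pos (Real.rpow_pos_of_pos hs p)]
  · intro p hp s hs a b
    rw [← mul_sub, abs_scale hs]

lemma est_add {m M : ℝ} (h1 : 1 < m) : ∃ C : ℝ, 0 ≤ C ∧ ∀ p ∈ Icc m M, ∀ a b,
    |a + b| ^ p ≤ C * (|a| ^ p + |b| ^ p) := by
  have hpos : ∀ p ∈ Icc m M, 1 < p := fun p hp => h1.trans_le hp.1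
  obtain ⟨C, hC, h⟩ := HC m M h1 (fun p a b => |a + b| ^ p) (fun p a b => |a| ^ p + |b| ^ p)
    (cont_abs_rpow h1 (fun q => q.2.1 + q.2.2) (by fun_prop))
    ((cont_abs_rpow h1 (fun q => q.2.1) (by fun_prop)).add
      (cont_abs_rpow h1 (fun q => q.2.2) (by fun_prop)))
    (by
      intro p hp
      have := hpos p hp
      simp only [add_zero, abs_zero]
      rw [Real.zero_rpow (by linarith)])
    (by intro p hp a b; positivity)
    (by
      intro p hp a b h
      have h2 := hpos p hp
      have ha : 0 ≤ |a| ^ p := by positivity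
      have hb : 0 ≤ |b| ^ p := by positivity
      have ha' : |a| ^ p = 0 := by linarith
      have hb' : |b| ^ p = 0 := by linarith
      rw [Real.rpow_eq_zero (abs_nonneg _) (by linarith), abs_eq_zero] at ha' hb'
      subst ha'; subst hb'
      simp only [add_zero, abs_zero]
      rw [Real.zero_rpow (by linarith)])
    (by
      intro p hp s hs a b
      rw [← mul_add, abs_scale hs])
    (by
      intro p hp s hs a b
      rw [abs_scale hs, abs_scale hs, mul_add]) 1 one_pos
  exact ⟨1 + C, by positivity, fun p hp a b => (h p hp a b).trans (by rw [add_mul])⟩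

lemma est_young {m M : ℝ} (h1 : 1 < m) {ε : ℝ} (hε : 0 < ε) : ∃ C : ℝ, 0 ≤ C ∧
    ∀ p ∈ Icc m M, ∀ q, p.HolderConjugate q → ∀ a y,
    |y * a| ≤ ε * |a| ^ p + C * |y| ^ q := by
  have hpos : ∀ p ∈ Icc m M, 1 < p := fun p hp => h1.trans_le hp.1
  obtain ⟨C, hC, h⟩ := HC m M h1 (fun p a b => |zf p b * a|) (fun p a b => |b| ^ p)
    (((cont_zf h1 (fun q => q.2.2) (by fun_prop)).mul (by fun_prop)).abs)
    (cont_abs_rpow h1 (fun q => q.2.2) (by fun_prop))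
    (by
      intro p hp
      simp)
    (by intro p hp a b; positivity)
    (by
      intro p hp a b h
      have h2 := hpos p hp
      rw [Real.rpow_eq_zero (abs_nonneg _) (by linarith), abs_eq_zero] at h
      subst h
      simp [zf_zero])
    (by
      intro p hp s hs a b
      have := hpos p hp
      have e : s ^ p = s ^ (p - 1) * s := by
        nth_rewrite 3 [← Real.rpow_one s]
        rw [← Real.rpow_add hs]; congr 1; ring
      have e2 : s ^ (p - 1) * zf p b * (s * a) = s ^ p * (zf p b * a) := by rw [e]; ring
      rw [zf_scale hs this, e2, abs_mul, abs_of_pos (Real.rpow_pos_of_pos hs p)])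
    (by
      intro p hp s hs a b
      rw [abs_scale hs]) ε hε
  refine ⟨ε + C, by positivity, fun p hp q hpq a y => ?_⟩
  have := h p hp a (zf q y)
  rw [zf_inv hpq, abs_zf_rpow hpq.symm] at this
  linarith

structure Half {V W : Type*} [AddCommGroup V] [Module ℝ V] [AddCommGroup W] [Module ℝ W]
    (B : V →ₗ[ℝ] W →ₗ[ℝ] ℝ) (ψ ρ : V → ℝ) (Z : V → W) : Prop where
  nonneg : ∀ x, 0 ≤ ψ x
  bd : ∀ a, ∃ C, ∀ x, |B x a| ≤ 1 / 2 * ψ x + C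
  cvx : ∀ x y, ψ ((1 / 2 : ℝ) • (x + y)) ≤ (ψ x + ψ y) / 2
  uc : ∀ M, ∀ ε > 0, ∃ δ > 0, ∀ x y, ψ x ≤ M → ψ y ≤ M →
    (ψ x + ψ y) / 2 - ψ ((1 / 2 : ℝ) • (x + y)) ≤ δ → ρ (x - y) ≤ ε
  comp : ∀ x : ℕ → V, (∀ ε > 0, ∃ N, ∀ n ≥ N, ∀ k ≥ N, ρ (x n - x k) ≤ ε) →
    ∃ l, Tendsto (fun n => ρ (x n - l)) atTop (𝓝 0)
  cont : ∀ (x : ℕ → V) l, Tendsto (fun n => ρ (x n - l)) atTop (𝓝 0) →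
    Tendsto (fun n => ψ (x n)) atTop (𝓝 (ψ l))
  contB : ∀ (x : ℕ → V) l a, Tendsto (fun n => ρ (x n - l)) atTop (𝓝 0) →
    Tendsto (fun n => B (x n) a) atTop (𝓝 (B l a))
  grad : ∀ x h, ∃ e : ℕ → ℝ, Tendsto e atTop (𝓝 (B h (Z x))) ∧
    ∀ n : ℕ, ψ (x + (1 / ((n : ℝ) + 1)) • h) ≤ ψ x + (1 / ((n : ℝ) + 1)) * e n

theorem abstract_surj {V W : Type*} [AddCommGroup V] [Module ℝ V] [AddCommGroup W] [Module ℝ W]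
    (B : V →ₗ[ℝ] W →ₗ[ℝ] ℝ) (ψ ρ : V → ℝ) (ψ' ρ' : W → ℝ) (Z : V → W) (Z' : W → V)
    (hV : Half B ψ ρ Z) (hW : Half B.flip ψ' ρ' Z')
    (young : ∀ x y, 0 ≤ B x y + ψ x + ψ' y)
    (mono : ∀ x y, 0 ≤ B (x - y) (Z x - Z y))
    (inv : ∀ h y, B h (Z (-(Z' y))) = - B h y)
    (A : Set (V × W)) (hA : ∀ q ∈ A, ∀ r ∈ A, 0 ≤ B (q.1 - r.1) (q.2 - r.2))
    (hmax : ∀ u ξ, (∀ r ∈ A, 0 ≤ B (u - r.1) (ξ - r.2)) → (u, ξ) ∈ A) :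
    ∃ x0 y0, (y0, -Z x0) ∈ A ∧ B (x0 - y0) (Z x0 - Z y0) ≤ 0 := by
  set K : Set ((V × W) × ℝ) := {k | ∀ r ∈ A, B k.1.1 r.2 + B r.1 k.1.2 - B r.1 r.2 ≤ k.2} with hK
  set H : (V × W) × ℝ → ℝ := fun k => k.2 + ψ k.1.1 + ψ' k.1.2 with hH
  -- members of A
  have hAK : ∀ q ∈ A, (q, B q.1 q.2) ∈ K := by
    intro q hq r hr
    have := hA q hq r hr
    simp only [map_sub, LinearMap.sub_apply] at this ⊢
    linarith
  -- Fitzpatrick inequality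
  have hfitz : ∀ k ∈ K, B k.1.1 k.1.2 ≤ k.2 := by
    intro k hk
    by_contra hcon
    push Not at hcon
    have hmem : (k.1.1, k.1.2) ∈ A := by
      apply hmax
      intro r hr
      have := hk r hr
      simp only [map_sub, LinearMap.sub_apply]
      linarith
    have := hk _ hmem
    simp only at this
    linarith
  have hHnn : ∀ k ∈ K, 0 ≤ H k := by
    intro k hk
    have h1 := hfitz k hk
    have h2 := young k.1.1 k.1.2
    simp only [hH]; linarith
  have hAne : A.Nonempty := by
    by_contra hne
    rw [not_nonempty_iff_eq_empty] at hne
    have := hmax 0 0 (by rw [hne]; simp)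
    rw [hne] at this; exact this
  obtain ⟨a0, ha0⟩ := hAne
  set S : Set ℝ := H '' K
  have hSne : S.Nonempty := ⟨_, ⟨_, hAK a0 ha0, rfl⟩⟩
  have hSb : BddBelow S := ⟨0, by rintro _ ⟨k, hk, rfl⟩; exact hHnn k hk⟩
  set m := sInf S with hm
  have hmle : ∀ k ∈ K, m ≤ H k := fun k hk => csInf_le hSb ⟨k, hk, rfl⟩
  have hseq : ∀ n : ℕ, ∃ k ∈ K, H k < m + 1 / ((n : ℝ) + 1) := by
    intro n
    obtain ⟨_, ⟨k, hk, rfl⟩, h⟩ := exists_lt_of_csInf_lt hSne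
      (show m < m + 1 / ((n : ℝ) + 1) by have : 0 < 1 / ((n : ℝ) + 1) := by positivity
                                         linarith)
    exact ⟨k, hk, h⟩
  choose k hkK hkH using hseq
  have hs0 : Tendsto (fun n : ℕ => 1 / ((n : ℝ) + 1)) atTop (𝓝 0) :=
    tendsto_one_div_add_atTop_nhds_zero_nat
  have hle1 : ∀ n : ℕ, 1 / ((n : ℝ) + 1) ≤ 1 := fun n => by
    rw [div_le_one (by positivity)]; linarith [n.cast_nonneg (α := ℝ)]
  have hpos : ∀ n : ℕ, 0 < 1 / ((n : ℝ) + 1) := fun n => by positivity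
  -- boundedness
  obtain ⟨C1, hC1⟩ := hV.bd a0.2
  obtain ⟨C2, hC2⟩ := hW.bd a0.1
  have hbnd : ∀ n, ψ (k n).1.1 + ψ' (k n).1.2 ≤ 2 * (m + 1 + C1 + C2 + B a0.1 a0.2) := by
    intro n
    have h1 := hkK n a0 ha0
    have h2 := hkH n
    have h3 := neg_le_of_abs_le (hC1 (k n).1.1)
    have h4 := neg_le_of_abs_le (hC2 (k n).1.2)
    rw [LinearMap.flip_apply] at h4
    have h5 := hle1 n
    simp only [hH] at h2
    linarith
  set R := 2 * (m + 1 + C1 + C2 + B a0.1 a0.2)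
  have hb1 : ∀ n, ψ (k n).1.1 ≤ R := fun n => by linarith [hbnd n, hW.nonneg (k n).1.2]
  have hb2 : ∀ n, ψ' (k n).1.2 ≤ R := fun n => by linarith [hbnd n, hV.nonneg (k n).1.1]
  -- midpoint
  have hdef : ∀ i j, ((ψ (k i).1.1 + ψ (k j).1.1) / 2 - ψ ((1/2:ℝ) • ((k i).1.1 + (k j).1.1))) +
      ((ψ' (k i).1.2 + ψ' (k j).1.2) / 2 - ψ' ((1/2:ℝ) • ((k i).1.2 + (k j).1.2))) ≤
      (1 / ((i : ℝ) + 1) + 1 / ((j : ℝ) + 1)) / 2 := by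
    intro i j
    have hmid : (((1/2:ℝ) • ((k i).1.1 + (k j).1.1), (1/2:ℝ) • ((k i).1.2 + (k j).1.2)),
        ((k i).2 + (k j).2) / 2) ∈ K := by
      intro r hr
      have h1 := hkK i r hr
      have h2 := hkK j r hr
      simp only [map_add, map_smul, LinearMap.add_apply, LinearMap.smul_apply, smul_eq_mul]
      linarith
    have h3 := hmle _ hmid
    have h4 := hkH i
    have h5 := hkH j
    simp only [hH] at h3 h4 h5
    linarith
  have hcauchy : ∀ δ > 0, ∃ N : ℕ, ∀ i ≥ N, ∀ j ≥ N,
      (1 / ((i : ℝ) + 1) + 1 / ((j : ℝ) + 1)) / 2 ≤ δ := by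
    intro δ hδ
    obtain ⟨N, hN⟩ := eventually_atTop.1 (hs0.eventually_lt_const hδ)
    refine ⟨N, fun i hi j hj => ?_⟩
    linarith [hN i hi, hN j hj]
  obtain ⟨x0, hx0⟩ := hV.comp (fun n => (k n).1.1) (by
    intro ε hε
    obtain ⟨δ, hδ, h⟩ := hV.uc R ε hε
    obtain ⟨N, hN⟩ := hcauchy δ hδ
    refine ⟨N, fun i hi j hj => h _ _ (hb1 i) (hb1 j) ?_⟩
    have h1 := hdef i j
    have h2 := hN i hi j hj
    have h3 := hW.cvx (k i).1.2 (k j).1.2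
    linarith)
  obtain ⟨y0, hy0⟩ := hW.comp (fun n => (k n).1.2) (by
    intro ε hε
    obtain ⟨δ, hδ, h⟩ := hW.uc R ε hε
    obtain ⟨N, hN⟩ := hcauchy δ hδ
    refine ⟨N, fun i hi j hj => h _ _ (hb2 i) (hb2 j) ?_⟩
    have h1 := hdef i j
    have h2 := hN i hi j hj
    have h3 := hV.cvx (k i).1.1 (k j).1.1
    linarith)
  have hHlim : Tendsto (fun n => H (k n)) atTop (𝓝 m) := by
    refine tendsto_of_tendsto_of_tendsto_of_le_of_le tendsto_const_nhds
      (by simpa using hs0.const_add m) (fun n => hmle _ (hkK n)) (fun n => (hkH n).le)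
  have hψ := hV.cont _ _ hx0
  have hψ' := hW.cont _ _ hy0
  set t0 := m - ψ x0 - ψ' y0 with ht0
  have htlim : Tendsto (fun n => (k n).2) atTop (𝓝 t0) := by
    refine ((hHlim.sub hψ).sub hψ').congr fun n => ?_
    simp only [hH]; ring
  have hzK : ((x0, y0), t0) ∈ K := by
    intro r hr
    have h1 := hV.contB _ _ r.2 hx0
    have h2 := hW.contB _ _ r.1 hy0
    simp only [LinearMap.flip_apply] at h2
    exact le_of_tendsto_of_tendsto' ((h1.add h2).sub_const _) htlim (fun n => hkK n r hr)
  -- optimality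
  have hopt : ∀ q ∈ A, 0 ≤ B q.1 q.2 - t0 + B (q.1 - x0) (Z x0) + B (Z' y0) (q.2 - y0) := by
    intro q hq
    obtain ⟨e, he, hge⟩ := hV.grad x0 (q.1 - x0)
    obtain ⟨e', he', hge'⟩ := hW.grad y0 (q.2 - y0)
    rw [LinearMap.flip_apply] at he'
    refine ge_of_tendsto' ((he.const_add (B q.1 q.2 - t0)).add he') fun n => ?_
    have h1 := hge n
    have h2 := hge' n
    set s := 1 / ((n : ℝ) + 1) with hs
    have hsp : 0 < s := hpos n
    have hs1 : s ≤ 1 := hle1 n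
    have hmem : ((x0 + s • (q.1 - x0), y0 + s • (q.2 - y0)), t0 + s * (B q.1 q.2 - t0)) ∈ K := by
      intro r hr
      have h3 := hzK r hr
      have h4 := hAK q hq r hr
      simp only [map_add, map_sub, map_smul, LinearMap.add_apply, LinearMap.sub_apply,
        LinearMap.smul_apply, smul_eq_mul] at h3 h4 ⊢
      nlinarith [mul_le_mul_of_nonneg_left h4 hsp.le,
        mul_le_mul_of_nonneg_left h3 (sub_nonneg.2 hs1)]
    have h5 := hmle _ hmem
    simp only [hH] at h5
    have h6 : 0 ≤ s * (B q.1 q.2 - t0 + e n + e' n) := by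
      linarith
    exact nonneg_of_mul_nonneg_right h6 hsp
  set y1 := -(Z' y0) with hy1
  have hinv : ∀ h, B h (Z y1) = - B h y0 := fun h => inv h y0
  have hfz := hfitz _ hzK
  simp only at hfz
  have hmon := mono x0 y1
  have hmono' : B (x0 - y1) (Z x0 - Z y1) = B x0 (Z x0) - B y1 (Z x0) + B x0 y0 - B y1 y0 := by
    simp only [map_sub, LinearMap.sub_apply, hinv]; ring
  have hge : ∀ q ∈ A, B (x0 - y1) (Z x0 - Z y1) ≤ B (q.1 - y1) (q.2 + Z x0) := by
    intro q hq
    have h1 := hopt q hq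
    have e : Z' y0 = - y1 := by simp [hy1]
    rw [e] at h1
    rw [hmono']
    simp only [map_sub, map_add, map_neg, LinearMap.sub_apply, LinearMap.neg_apply] at h1 ⊢
    linarith
  have hmem : (y1, -Z x0) ∈ A := by
    apply hmax
    intro r hr
    have h1 := hge r hr
    have : B (y1 - r.1) (-Z x0 - r.2) = B (r.1 - y1) (r.2 + Z x0) := by
      simp only [map_sub, map_add, map_neg, LinearMap.sub_apply]; ring
    rw [this]; linarith
  refine ⟨x0, y1, hmem, ?_⟩
  have := hge _ hmem
  simpa using this

structure PQ {α : Type*} [MeasurableSpace α] (μ : Measure α) (p q : α → ℝ) (m M : ℝ) : Prop where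
  hp : Measurable p
  hq : Measurable q
  h1 : 1 < m
  hmM : m ≤ M
  hpa : ∀ᵐ x ∂μ, p x ∈ Icc m M
  hqa : ∀ᵐ x ∂μ, q x ∈ Icc m M
  hc : ∀ᵐ x ∂μ, (p x).HolderConjugate (q x)

/-- real modular -/
def rho {α : Type*} [MeasurableSpace α] (μ : Measure α) (p : α → ℝ) (u : α → ℝ) : ℝ :=
  ∫ x, |u x| ^ p x ∂μ

/-- weighted modular -/
def psi {α : Type*} [MeasurableSpace α] (μ : Measure α) (p : α → ℝ) (u : α → ℝ) : ℝ :=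
  ∫ x, |u x| ^ p x / p x ∂μ

namespace PQ

variable {α : Type*} [MeasurableSpace α] {μ : Measure α} {p q : α → ℝ} {m M : ℝ}

lemma symm (h : PQ μ p q m M) : PQ μ q p m M :=
  ⟨h.hq, h.hp, h.h1, h.hmM, h.hqa, h.hpa, h.hc.mono fun _ hx => hx.symm⟩

lemma aem (h : PQ μ p q m M) {u : α → ℝ} (hu : AEMeasurable u μ) :
    AEMeasurable (fun x => |u x| ^ p x) μ :=
  (continuous_abs.measurable.comp_aemeasurable hu).pow h.hp.aemeasurable

lemma mem_iff (h : PQ μ p q m M) {u : α → ℝ} :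
    MemVLp μ p u ↔ AEMeasurable u μ ∧ Integrable (fun x => |u x| ^ p x) μ := by
  constructor
  · rintro ⟨h1, h2⟩
    refine ⟨h1, (h.aem h1).aestronglyMeasurable, ?_⟩
    rw [hasFiniteIntegral_iff_ofReal (Eventually.of_forall fun x => by positivity)]
    exact h2
  · rintro ⟨h1, h2⟩
    refine ⟨h1, ?_⟩
    have := h2.2
    rwa [hasFiniteIntegral_iff_ofReal (Eventually.of_forall fun x => by positivity)] at this

lemma int (h : PQ μ p q m M) {u : α → ℝ} (hu : MemVLp μ p u) :
    Integrable (fun x => |u x| ^ p x) μ := (h.mem_iff.1 hu).2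

lemma mod_eq (h : PQ μ p q m M) {u : α → ℝ} (hu : MemVLp μ p u) :
    vModular μ p u = ENNReal.ofReal (rho μ p u) := by
  rw [rho, ofReal_integral_eq_lintegral_ofReal (h.int hu)
    (Eventually.of_forall fun x => by positivity)]
  rfl

lemma rho_nonneg (u : α → ℝ) : 0 ≤ rho μ p u := integral_nonneg fun x => by positivity

lemma mem_of_le (h : PQ μ p q m M) {u : α → ℝ} (hu : AEMeasurable u μ) {g : α → ℝ}
    (hg : Integrable g μ) (hle : ∀ᵐ x ∂μ, |u x| ^ p x ≤ g x) : MemVLp μ p u := by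
  refine h.mem_iff.2 ⟨hu, hg.mono' (h.aem hu).aestronglyMeasurable ?_⟩
  filter_upwards [hle] with x hx
  rwa [Real.norm_eq_abs, abs_of_nonneg (by positivity)]

lemma mem_zero (h : PQ μ p q m M) : MemVLp μ p (0 : α → ℝ) := by
  refine h.mem_of_le aemeasurable_const (integrable_zero α ℝ μ) ?_
  filter_upwards [h.hc] with x hx
  simp [Real.zero_rpow hx.pos.ne']

lemma mem_add (h : PQ μ p q m M) {u v : α → ℝ} (hu : MemVLp μ p u) (hv : MemVLp μ p v) :
    MemVLp μ p (u + v) := by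
  obtain ⟨C, hC, hest⟩ := est_add (M := M) h.h1
  refine h.mem_of_le (hu.1.add hv.1) (((h.int hu).add (h.int hv)).const_mul C) ?_
  filter_upwards [h.hpa] with x hx
  exact hest _ hx _ _

lemma mem_smul (h : PQ μ p q m M) (c : ℝ) {u : α → ℝ} (hu : MemVLp μ p u) :
    MemVLp μ p (c • u) := by
  refine h.mem_of_le (hu.1.const_smul c) ((h.int hu).const_mul ((max 1 |c|) ^ M)) ?_
  filter_upwards [h.hpa] with x hx
  have h1 := h.h1
  have hp0 : 0 ≤ p x := by have := hx.1; linarith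
  simp only [Pi.smul_apply, smul_eq_mul]
  rw [abs_mul, Real.mul_rpow (abs_nonneg _) (abs_nonneg _)]
  refine mul_le_mul_of_nonneg_right ?_ (by positivity)
  exact (Real.rpow_le_rpow (abs_nonneg _) (le_max_right _ _) hp0).trans
    (Real.rpow_le_rpow_of_exponent_le (le_max_left _ _) hx.2)

/-- the function space -/
def V (h : PQ μ p q m M) : Submodule ℝ (α → ℝ) where
  carrier := {u | MemVLp μ p u}
  add_mem' := fun hu hv => h.mem_add hu hv
  zero_mem' := h.mem_zero
  smul_mem' := fun c _ hu => h.mem_smul c hu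

lemma mem_sub (h : PQ μ p q m M) {u v : α → ℝ} (hu : MemVLp μ p u) (hv : MemVLp μ p v) :
    MemVLp μ p (u - v) := h.V.sub_mem hu hv

lemma mem_z (h : PQ μ p q m M) {u : α → ℝ} (hu : MemVLp μ p u) : MemVLp μ q (zOp p u) := by
  refine h.symm.mem_of_le ?_ (h.int hu) ?_
  · exact ((continuous_abs.measurable.comp_aemeasurable hu.1).pow
      (h.hp.sub_const 2).aemeasurable).mul hu.1
  · filter_upwards [h.hc] with x hx
    exact (abs_zf_rpow hx).le

lemma rho_z (h : PQ μ p q m M) (u : α → ℝ) : rho μ q (zOp p u) = rho μ p u := by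
  refine integral_congr_ae ?_
  filter_upwards [h.hc] with x hx
  exact abs_zf_rpow hx

lemma int_mul (h : PQ μ p q m M) {u ξ : α → ℝ} (hu : MemVLp μ p u) (hξ : MemVLp μ q ξ) :
    Integrable (fun x => ξ x * u x) μ := by
  obtain ⟨C, hC, hest⟩ := est_young (M := M) h.h1 one_pos
  refine (((h.int hu).const_mul 1).add ((h.symm.int hξ).const_mul C)).mono'
    (hξ.1.mul hu.1).aestronglyMeasurable ?_
  filter_upwards [h.hpa, h.hc] with x hx hx2
  exact hest _ hx _ hx2 _ _

lemma pair_le (h : PQ μ p q m M) {ε : ℝ} (hε : 0 < ε) : ∃ C : ℝ, 0 ≤ C ∧ ∀ u ξ : α → ℝ,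
    MemVLp μ p u → MemVLp μ q ξ → |∫ x, ξ x * u x ∂μ| ≤ ε * rho μ p u + C * rho μ q ξ := by
  obtain ⟨C, hC, hest⟩ := est_young (M := M) h.h1 hε
  refine ⟨C, hC, fun u ξ hu hξ => ?_⟩
  refine (abs_integral_le_integral_abs).trans ?_
  rw [rho, rho, ← integral_const_mul, ← integral_const_mul, ← integral_add
    ((h.int hu).const_mul ε) ((h.symm.int hξ).const_mul C)]
  refine integral_mono_ae (h.int_mul hu hξ).abs
    (((h.int hu).const_mul ε).add ((h.symm.int hξ).const_mul C)) ?_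
  filter_upwards [h.hpa, h.hc] with x hx hx2
  exact hest _ hx _ hx2 _ _

lemma int_psi (h : PQ μ p q m M) {u : α → ℝ} (hu : MemVLp μ p u) :
    Integrable (fun x => |u x| ^ p x / p x) μ := by
  refine (h.int hu).mono' ((h.aem hu.1).div h.hp.aemeasurable).aestronglyMeasurable ?_
  filter_upwards [h.hc] with x hx
  have := hx.lt
  rw [Real.norm_eq_abs, abs_of_nonneg (by positivity)]
  exact div_le_self (by positivity) this.le

lemma psi_nonneg (h : PQ μ p q m M) (u : α → ℝ) : 0 ≤ psi μ p u := by
  refine integral_nonneg_of_ae ?_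
  filter_upwards [h.hc] with x hx
  have := hx.pos
  simp only [Pi.zero_apply]
  positivity

lemma rho_le_psi (h : PQ μ p q m M) {u : α → ℝ} (hu : MemVLp μ p u) :
    rho μ p u ≤ M * psi μ p u := by
  rw [rho, psi, ← integral_const_mul]
  refine integral_mono_ae (h.int hu) ((h.int_psi hu).const_mul M) ?_
  filter_upwards [h.hc, h.hpa] with x hx hx2
  have := hx.pos
  have h3 : 0 ≤ |u x| ^ p x := by positivity
  show |u x| ^ p x ≤ M * (|u x| ^ p x / p x)
  rw [← mul_div_assoc, le_div_iff₀ this, mul_comm]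
  exact mul_le_mul_of_nonneg_right hx2.2 h3

lemma int_dfc (h : PQ μ p q m M) {u v : α → ℝ} (hu : MemVLp μ p u) (hv : MemVLp μ p v) :
    Integrable (fun x => dfc (p x) (u x) (v x)) μ :=
  (((h.int_psi hu).add (h.int_psi hv)).div_const 2).sub
    (h.int_psi (h.mem_smul (1/2) (h.mem_add hu hv)))

lemma defect (h : PQ μ p q m M) {u v : α → ℝ} (hu : MemVLp μ p u) (hv : MemVLp μ p v) :
    (psi μ p u + psi μ p v) / 2 - psi μ p ((1 / 2 : ℝ) • (u + v)) =
      ∫ x, dfc (p x) (u x) (v x) ∂μ := by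
  have i1 : Integrable (fun x => (|u x| ^ p x / p x + |v x| ^ p x / p x) / 2) μ :=
    ((h.int_psi hu).add (h.int_psi hv)).div_const 2
  have i2 : Integrable (fun x => |(1 / 2) * (u x + v x)| ^ p x / p x) μ :=
    h.int_psi (h.mem_smul (1/2) (h.mem_add hu hv))
  unfold dfc psi
  rw [integral_sub i1 i2, integral_div, integral_add (h.int_psi hu) (h.int_psi hv)]
  rfl

lemma rho_sub_le (h : PQ μ p q m M) {ε : ℝ} (hε : 0 < ε) : ∃ C : ℝ, 0 ≤ C ∧ ∀ u v : α → ℝ,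
    MemVLp μ p u → MemVLp μ p v → rho μ p (u - v) ≤ ε * (rho μ p u + rho μ p v) +
      C * ((psi μ p u + psi μ p v) / 2 - psi μ p ((1 / 2 : ℝ) • (u + v))) := by
  obtain ⟨C, hC, hest⟩ := est_uc (M := M) h.h1 hε
  refine ⟨C, hC, fun u v hu hv => ?_⟩
  have i1 : Integrable (fun x => ε * (|u x| ^ p x + |v x| ^ p x)) μ :=
    ((h.int hu).add (h.int hv)).const_mul ε
  have i2 := (h.int_dfc hu hv).const_mul C
  rw [h.defect hu hv, rho, rho, rho, ← integral_add (h.int hu) (h.int hv), ← integral_const_mul,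
    ← integral_const_mul, ← integral_add i1 i2]
  refine integral_mono_ae (h.int (h.mem_sub hu hv)) (i1.add i2) ?_
  filter_upwards [h.hpa] with x hx
  exact hest _ hx _ _

lemma rho_z_sub_le (h : PQ μ p q m M) {ε : ℝ} (hε : 0 < ε) : ∃ C : ℝ, 0 ≤ C ∧ ∀ u v : α → ℝ,
    MemVLp μ p u → MemVLp μ p v → rho μ q (zOp p u - zOp p v) ≤ ε * (rho μ p u + rho μ p v) +
      C * rho μ p (u - v) := by
  obtain ⟨C, hC, hest⟩ := est_z (M := M) h.h1 hε
  refine ⟨C, hC, fun u v hu hv => ?_⟩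
  have i1 : Integrable (fun x => ε * (|u x| ^ p x + |v x| ^ p x)) μ :=
    ((h.int hu).add (h.int hv)).const_mul ε
  have i2 := (h.int (h.mem_sub hu hv)).const_mul C
  rw [rho, rho, rho, rho, ← integral_add (h.int hu) (h.int hv), ← integral_const_mul,
    ← integral_const_mul, ← integral_add i1 i2]
  refine integral_mono_ae (h.symm.int (h.symm.mem_sub (h.mem_z hu) (h.mem_z hv))) (i1.add i2) ?_
  filter_upwards [h.hpa, h.hc] with x hx hx2
  have := hest _ hx (u x) (v x)
  rw [← hx2.conjugate_eq] at this
  exact this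

lemma psi_sub_le (h : PQ μ p q m M) {ε : ℝ} (hε : 0 < ε) : ∃ C : ℝ, 0 ≤ C ∧ ∀ u v : α → ℝ,
    MemVLp μ p u → MemVLp μ p v → |psi μ p u - psi μ p v| ≤ ε * (rho μ p u + rho μ p v) +
      C * rho μ p (u - v) := by
  obtain ⟨C, hC, hest⟩ := est_phi (M := M) h.h1 hε
  refine ⟨C, hC, fun u v hu hv => ?_⟩
  have i1 : Integrable (fun x => ε * (|u x| ^ p x + |v x| ^ p x)) μ :=
    ((h.int hu).add (h.int hv)).const_mul ε
  have i2 := (h.int (h.mem_sub hu hv)).const_mul C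
  rw [psi, psi, ← integral_sub (h.int_psi hu) (h.int_psi hv)]
  refine abs_integral_le_integral_abs.trans ?_
  rw [rho, rho, rho, ← integral_add (h.int hu) (h.int hv), ← integral_const_mul,
    ← integral_const_mul, ← integral_add i1 i2]
  refine integral_mono_ae ((h.int_psi hu).sub (h.int_psi hv)).abs (i1.add i2) ?_
  filter_upwards [h.hpa] with x hx
  exact hest _ hx (u x) (v x)

lemma squeeze {d b r : ℕ → ℝ} {D : ℝ} (hb : ∀ n, b n ≤ D) (hr : Tendsto r atTop (𝓝 0))
    (hest : ∀ ε > 0, ∃ C : ℝ, 0 ≤ C ∧ ∀ n, |d n| ≤ ε * b n + C * r n) :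
    Tendsto d atTop (𝓝 0) := by
  rw [Metric.tendsto_atTop]
  intro ε hε
  obtain ⟨C, hC, h⟩ := hest (ε / (2 * (|D| + 1))) (by positivity)
  have h2 : Tendsto (fun n => C * r n) atTop (𝓝 0) := by simpa using hr.const_mul C
  obtain ⟨N, hN⟩ := eventually_atTop.1 (h2.eventually_lt_const (half_pos hε))
  refine ⟨N, fun n hn => ?_⟩
  rw [Real.dist_eq, sub_zero]
  have h3 := h n
  have h4 := hN n hn
  have h5 : ε / (2 * (|D| + 1)) * b n ≤ ε / 2 := by
    have : b n ≤ |D| + 1 := by linarith [hb n, le_abs_self D]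
    calc _ ≤ ε / (2 * (|D| + 1)) * (|D| + 1) := mul_le_mul_of_nonneg_left this (by positivity)
      _ = ε / 2 := by field_simp
  linarith

lemma rho_bdd (h : PQ μ p q m M) {u : ℕ → α → ℝ} {v : α → ℝ} (hu : ∀ n, MemVLp μ p (u n))
    (hv : MemVLp μ p v) (hr : Tendsto (fun n => rho μ p (u n - v)) atTop (𝓝 0)) :
    ∃ D, ∀ n, rho μ p (u n) + rho μ p v ≤ D := by
  obtain ⟨C, hC, hest⟩ := est_add (M := M) h.h1
  obtain ⟨D, hD⟩ := hr.bddAbove_range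
  refine ⟨C * (D + rho μ p v) + rho μ p v, fun n => ?_⟩
  have h1 : rho μ p (u n) ≤ C * (rho μ p (u n - v) + rho μ p v) := by
    have i := h.int (h.mem_sub (hu n) hv)
    rw [rho, rho, rho, ← integral_add i (h.int hv), ← integral_const_mul]
    refine integral_mono_ae (h.int (hu n)) ((i.add (h.int hv)).const_mul C) ?_
    filter_upwards [h.hpa] with x hx
    have := hest _ hx (u n x - v x) (v x)
    rw [sub_add_cancel] at this
    exact this
  have h2 : rho μ p (u n - v) ≤ D := hD ⟨n, rfl⟩
  have := mul_le_mul_of_nonneg_left (add_le_add_left h2 (rho μ p v)) hC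
  linarith

lemma cont_z (h : PQ μ p q m M) {u : ℕ → α → ℝ} {v : α → ℝ} (hu : ∀ n, MemVLp μ p (u n))
    (hv : MemVLp μ p v) (hr : Tendsto (fun n => rho μ p (u n - v)) atTop (𝓝 0)) :
    Tendsto (fun n => rho μ q (zOp p (u n) - zOp p v)) atTop (𝓝 0) := by
  obtain ⟨D, hD⟩ := h.rho_bdd hu hv hr
  refine squeeze hD hr fun ε hε => ?_
  obtain ⟨C, hC, hest⟩ := h.rho_z_sub_le hε
  refine ⟨C, hC, fun n => ?_⟩
  rw [abs_of_nonneg (rho_nonneg _)]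
  exact hest _ _ (hu n) hv

lemma cont_psi (h : PQ μ p q m M) {u : ℕ → α → ℝ} {v : α → ℝ} (hu : ∀ n, MemVLp μ p (u n))
    (hv : MemVLp μ p v) (hr : Tendsto (fun n => rho μ p (u n - v)) atTop (𝓝 0)) :
    Tendsto (fun n => psi μ p (u n)) atTop (𝓝 (psi μ p v)) := by
  obtain ⟨D, hD⟩ := h.rho_bdd hu hv hr
  rw [← tendsto_sub_nhds_zero_iff]
  refine squeeze hD hr fun ε hε => ?_
  obtain ⟨C, hC, hest⟩ := h.psi_sub_le hε
  exact ⟨C, hC, fun n => hest _ _ (hu n) hv⟩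

lemma cont_pair (h : PQ μ p q m M) {u : ℕ → α → ℝ} {v ξ : α → ℝ} (hu : ∀ n, MemVLp μ p (u n))
    (hv : MemVLp μ p v) (hξ : MemVLp μ q ξ)
    (hr : Tendsto (fun n => rho μ p (u n - v)) atTop (𝓝 0)) :
    Tendsto (fun n => ∫ x, ξ x * u n x ∂μ) atTop (𝓝 (∫ x, ξ x * v x ∂μ)) := by
  rw [← tendsto_sub_nhds_zero_iff]
  refine squeeze (b := fun _ => rho μ q ξ) (fun _ => le_rfl) hr fun ε hε => ?_
  obtain ⟨C, hC, hest⟩ := h.symm.pair_le hε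
  refine ⟨C, hC, fun n => ?_⟩
  have := hest ξ (u n - v) hξ (h.mem_sub (hu n) hv)
  rw [← integral_sub (h.int_mul (hu n) hξ) (h.int_mul hv hξ)]
  refine le_trans (le_of_eq ?_) this
  congr 2
  ext x
  simp only [Pi.sub_apply]; ring

lemma rho_smul_le (h : PQ μ p q m M) {c : ℝ} (hc : 0 < c) (hc1 : c ≤ 1) {u : α → ℝ}
    (hu : MemVLp μ p u) : rho μ p (c • u) ≤ c ^ m * rho μ p u := by
  rw [rho, rho, ← integral_const_mul]
  refine integral_mono_ae (h.int (h.mem_smul c hu)) ((h.int hu).const_mul _) ?_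
  filter_upwards [h.hpa] with x hx
  simp only [Pi.smul_apply, smul_eq_mul]
  rw [abs_scale hc]
  exact mul_le_mul_of_nonneg_right (Real.rpow_le_rpow_of_exponent_ge hc hc1 hx.1) (by positivity)

lemma rho_smul_le' (h : PQ μ p q m M) {c : ℝ} (hc1 : 1 ≤ c) {u : α → ℝ}
    (hu : MemVLp μ p u) : rho μ p (c • u) ≤ c ^ M * rho μ p u := by
  rw [rho, rho, ← integral_const_mul]
  refine integral_mono_ae (h.int (h.mem_smul c hu)) ((h.int hu).const_mul _) ?_
  filter_upwards [h.hpa] with x hx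
  simp only [Pi.smul_apply, smul_eq_mul]
  rw [abs_scale (by linarith)]
  exact mul_le_mul_of_nonneg_right (Real.rpow_le_rpow_of_exponent_le hc1 hx.2) (by positivity)

lemma rho_smul_le_self (h : PQ μ p q m M) {c : ℝ} (hc : 0 < c) (hc1 : c ≤ 1) {u : α → ℝ}
    (hu : MemVLp μ p u) : rho μ p (c • u) ≤ c * rho μ p u := by
  refine (h.rho_smul_le hc hc1 hu).trans (mul_le_mul_of_nonneg_right ?_ (rho_nonneg _))
  calc c ^ m ≤ c ^ (1:ℝ) := Real.rpow_le_rpow_of_exponent_ge hc hc1 h.h1.le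
    _ = c := Real.rpow_one c

lemma grad (h : PQ μ p q m M) {u k : α → ℝ} (hu : MemVLp μ p u) (hk : MemVLp μ p k) :
    ∃ e : ℕ → ℝ, Tendsto e atTop (𝓝 (∫ x, zOp p u x * k x ∂μ)) ∧
    ∀ n : ℕ, psi μ p (u + (1 / ((n : ℝ) + 1)) • k) ≤ psi μ p u + (1 / ((n : ℝ) + 1)) * e n := by
  have hm : ∀ n : ℕ, MemVLp μ p (u + (1 / ((n : ℝ) + 1)) • k) :=
    fun n => h.mem_add hu (h.mem_smul _ hk)
  refine ⟨fun n => ∫ x, zOp p (u + (1 / ((n : ℝ) + 1)) • k) x * k x ∂μ, ?_, fun n => ?_⟩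
  · have h1 : Tendsto (fun n : ℕ => rho μ p ((u + (1 / ((n : ℝ) + 1)) • k) - u)) atTop (𝓝 0) := by
      have h2 : Tendsto (fun n : ℕ => 1 / ((n : ℝ) + 1) * rho μ p k) atTop (𝓝 0) := by
        simpa using tendsto_one_div_add_atTop_nhds_zero_nat.mul_const (rho μ p k)
      refine squeeze_zero (fun n => rho_nonneg _) (fun n => ?_) h2
      rw [add_sub_cancel_left]
      refine h.rho_smul_le_self (by positivity) ?_ hk
      rw [div_le_one (by positivity)]; linarith [n.cast_nonneg (α := ℝ)]
    have h3 := h.symm.cont_pair (fun n => h.mem_z (hm n)) (h.mem_z hu) hk (h.cont_z hm hu h1)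
    simpa only [mul_comm (k _)] using h3
  · rw [psi, psi, ← integral_const_mul, ← integral_add (h.int_psi hu)
      ((h.int_mul hk (h.mem_z (hm n))).const_mul _)]
    refine integral_mono_ae (h.int_psi (hm n))
      ((h.int_psi hu).add ((h.int_mul hk (h.mem_z (hm n))).const_mul _)) ?_
    filter_upwards [h.hc] with x hx
    simp only [Pi.add_apply, Pi.smul_apply, smul_eq_mul]
    set s := 1 / ((n : ℝ) + 1)
    have e1 : zOp p (u + s • k) x = zf (p x) (u x + s * k x) := rfl
    rw [e1]
    set b := u x + s * k x with hb
    have h1 := Real.young_inequality (u x) (zf (p x) b) hx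
    rw [abs_zf_rpow hx] at h1
    have h2 := zf_mul_self (a := b) hx.lt
    have h3 : |b| ^ p x / p x + |b| ^ p x / q x = |b| ^ p x := by
      rw [div_eq_mul_inv, div_eq_mul_inv, ← mul_add, hx.inv_add_inv_eq_one, mul_one]
    have h4 : s * (zf (p x) b * k x) = zf (p x) b * b - zf (p x) b * u x := by rw [hb]; ring
    rw [h4]; linarith

lemma complete (h : PQ μ p q m M) {u : ℕ → α → ℝ} (hu : ∀ n, MemVLp μ p (u n))
    (hc : ∀ ε > 0, ∃ N, ∀ n ≥ N, ∀ k ≥ N, rho μ p (u n - u k) ≤ ε) :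
    ∃ v, MemVLp μ p v ∧ Tendsto (fun n => rho μ p (u n - v)) atTop (𝓝 0) := by
  -- subsequence
  obtain ⟨φ, hφ, hφ2⟩ := extraction_forall_of_eventually'
    (P := fun n k => ∀ j ≥ k, rho μ p ((2:ℝ) ^ n • (u k - u j)) ≤ (1 / 2) ^ n) (by
      intro n
      have hpos : 0 < ((2:ℝ) ^ n) ^ M := by positivity
      obtain ⟨N, hN⟩ := hc ((1 / 2) ^ n / ((2:ℝ) ^ n) ^ M) (by positivity)
      refine ⟨N, fun k hk j hj => ?_⟩
      refine (h.rho_smul_le' (one_le_pow₀ (by norm_num)) (h.mem_sub (hu k) (hu j))).trans ?_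
      have := hN k hk j (hk.trans hj)
      rw [le_div_iff₀ hpos] at this
      linarith)
  have hconv : ∀ᵐ x ∂μ, ∃ l, Tendsto (fun n => u (φ n) x) atTop (𝓝 l) := by
    set w : ℕ → α → ℝ := fun n => (2:ℝ) ^ n • (u (φ n) - u (φ (n + 1))) with hw
    have hwm : ∀ n, MemVLp μ p (w n) := fun n => h.mem_smul _ (h.mem_sub (hu _) (hu _))
    have hwr : ∀ n, rho μ p (w n) ≤ (1 / 2) ^ n := fun n => hφ2 n _ (hφ.monotone n.le_succ)
    have hmeas : ∀ n, AEMeasurable (fun x => ENNReal.ofReal (|w n x| ^ p x)) μ :=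
      fun n => (h.aem (hwm n).1).ennreal_ofReal
    have hsum : ∫⁻ x, ∑' n, ENNReal.ofReal (|w n x| ^ p x) ∂μ ≠ ⊤ := by
      rw [lintegral_tsum hmeas]
      have : ∀ n, ∫⁻ x, ENNReal.ofReal (|w n x| ^ p x) ∂μ ≤ ENNReal.ofReal ((1 / 2) ^ n) := by
        intro n
        have := h.mod_eq (hwm n)
        rw [vModular] at this
        rw [this]
        exact ENNReal.ofReal_le_ofReal (hwr n)
      refine ne_top_of_le_ne_top ?_ (ENNReal.tsum_le_tsum this)
      rw [← ENNReal.ofReal_tsum_of_nonneg (fun n => by positivity) summable_geometric_two]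
      exact ENNReal.ofReal_ne_top
    filter_upwards [ae_lt_top' (AEMeasurable.tsum hmeas) hsum, h.hc] with x hx hx2
    have h0 := ENNReal.tendsto_atTop_zero_of_tsum_ne_top hx.ne
    have h1 : ∀ᶠ n in atTop, |w n x| ≤ 1 := by
      filter_upwards [h0.eventually_lt_const (show (0:ℝ≥0∞) < 1 by norm_num)] with n hn
      by_contra hcon
      push Not at hcon
      have := Real.one_le_rpow hcon.le hx2.pos.le
      rw [ENNReal.ofReal_lt_one] at hn
      linarith
    obtain ⟨N, hN⟩ := eventually_atTop.1 h1
    have hcs : CauchySeq (fun n => u (φ (n + N)) x) := by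
      refine cauchySeq_of_le_geometric_two (C := 2) fun n => ?_
      have h2 := hN (n + N) (by omega)
      simp only [hw, Pi.smul_apply, Pi.sub_apply, smul_eq_mul] at h2
      rw [abs_mul, abs_of_pos (by positivity)] at h2
      rw [Real.dist_eq, show n + 1 + N = n + N + 1 by omega]
      rw [le_div_iff₀ (by positivity)]
      have h3 : (2:ℝ) ^ n ≤ 2 ^ (n + N) := pow_le_pow_right₀ (by norm_num) (by omega)
      have := mul_le_mul_of_nonneg_right h3 (abs_nonneg (u (φ (n + N)) x - u (φ (n + N + 1)) x))
      linarith
    obtain ⟨l, hl⟩ := cauchySeq_tendsto_of_complete hcs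
    exact ⟨l, (tendsto_add_atTop_iff_nat N).1 hl⟩
  obtain ⟨v, hvm, hv⟩ := measurable_limit_of_tendsto_metrizable_ae (fun n => (hu (φ n)).1) hconv
  -- Fatou
  have hfatou : ∀ ε > 0, ∃ N, ∀ n ≥ N, vModular μ p (u n - v) ≤ ENNReal.ofReal ε := by
    intro ε hε
    obtain ⟨N, hN⟩ := hc ε hε
    refine ⟨N, fun n hn => ?_⟩
    have h1 : vModular μ p (u n - v) = ∫⁻ x, liminf (fun k => ENNReal.ofReal
        (|u n x - u (φ k) x| ^ p x)) atTop ∂μ := by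
      refine lintegral_congr_ae ?_
      filter_upwards [hv, h.hc] with x hx hx2
      refine (Tendsto.liminf_eq ?_).symm
      refine ENNReal.tendsto_ofReal ?_
      exact ((hx.const_sub (u n x)).abs).rpow_const (Or.inr hx2.pos.le)
    rw [h1]
    refine (lintegral_liminf_le' fun k => ?_).trans ?_
    · exact (h.aem ((hu n).1.sub (hu (φ k)).1)).ennreal_ofReal
    · refine liminf_le_of_frequently_le' (Eventually.frequently ?_)
      filter_upwards [eventually_ge_atTop N] with k hk
      have h2 := h.mod_eq (h.mem_sub (hu n) (hu (φ k)))
      have h3 := hN n hn (φ k) (hk.trans (hφ.id_le k))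
      rw [vModular] at h2
      exact h2.le.trans (ENNReal.ofReal_le_ofReal h3)
  have hmem : MemVLp μ p v := by
    obtain ⟨N, hN⟩ := hfatou 1 one_pos
    have h1 : MemVLp μ p (u N - v) :=
      ⟨(hu N).1.sub hvm.aemeasurable, (hN N le_rfl).trans_lt ENNReal.ofReal_lt_top⟩
    have := h.mem_sub (hu N) h1
    rwa [sub_sub_cancel] at this
  refine ⟨v, hmem, ?_⟩
  rw [Metric.tendsto_atTop]
  intro ε hε
  obtain ⟨N, hN⟩ := hfatou (ε / 2) (by positivity)
  refine ⟨N, fun n hn => ?_⟩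
  have := hN n hn
  rw [h.mod_eq (h.mem_sub (hu n) hmem), ENNReal.ofReal_le_ofReal_iff (by positivity)] at this
  rw [Real.dist_eq, sub_zero, abs_of_nonneg (rho_nonneg _)]
  linarith

end PQ

namespace PQ

variable {α : Type*} [MeasurableSpace α] {μ : Measure α} {p q : α → ℝ} {m M : ℝ}

/-- pairing -/
def B (h : PQ μ p q m M) : h.V →ₗ[ℝ] h.symm.V →ₗ[ℝ] ℝ :=
  LinearMap.mk₂ ℝ (fun u ξ => ∫ x, ξ.1 x * u.1 x ∂μ)
    (fun u v ξ => by
      rw [← integral_add (h.int_mul u.2 ξ.2) (h.int_mul v.2 ξ.2)]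
      congr 1; ext x; simp [mul_add])
    (fun c u ξ => by
      rw [smul_eq_mul, ← integral_const_mul]
      congr 1; ext x; simp; ring)
    (fun u ξ η => by
      rw [← integral_add (h.int_mul u.2 ξ.2) (h.int_mul u.2 η.2)]
      congr 1; ext x; simp [add_mul])
    (fun c u ξ => by
      rw [smul_eq_mul, ← integral_const_mul]
      congr 1; ext x; simp; ring)

lemma B_apply (h : PQ μ p q m M) (u : h.V) (ξ : h.symm.V) : h.B u ξ = ∫ x, ξ.1 x * u.1 x ∂μ := rfl

lemma B_flip (h : PQ μ p q m M) : h.B.flip = h.symm.B := by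
  ext u ξ
  rw [LinearMap.flip_apply, B_apply, B_apply]
  congr 1; ext x; ring

/-- operator on the space -/
def Z (h : PQ μ p q m M) (u : h.V) : h.symm.V := ⟨zOp p u.1, h.mem_z u.2⟩

lemma half (h : PQ μ p q m M) :
    Half h.B (fun u => psi μ p u.1) (fun u => rho μ p u.1) h.Z where
  nonneg u := h.psi_nonneg _
  bd a := by
    have hM : 0 < M := by linarith [h.h1, h.hmM]
    obtain ⟨C, hC, hest⟩ := h.pair_le (ε := 1 / (2 * M)) (by positivity)
    refine ⟨C * rho μ q a.1, fun u => (hest _ _ u.2 a.2).trans ?_⟩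
    have := mul_le_mul_of_nonneg_left (h.rho_le_psi u.2) (show 0 ≤ 1 / (2 * M) by positivity)
    have e : 1 / (2 * M) * (M * psi μ p u.1) = 1 / 2 * psi μ p u.1 := by field_simp
    linarith
  cvx u v := by
    have h1 := h.defect u.2 v.2
    have h2 : 0 ≤ ∫ x, dfc (p x) (u.1 x) (v.1 x) ∂μ := by
      refine integral_nonneg_of_ae ?_
      filter_upwards [h.hc] with x hx
      exact dfc_nonneg hx.lt _ _
    have e : ((1 / 2 : ℝ) • (u + v) : h.V).1 = (1 / 2 : ℝ) • (u.1 + v.1) := rfl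
    simp only [e]
    linarith
  uc R ε hε := by
    have hM : 0 < M := by linarith [h.h1, h.hmM]
    obtain ⟨C, hC, hest⟩ := h.rho_sub_le (ε := ε / (4 * M * (|R| + 1))) (by positivity)
    refine ⟨ε / (2 * (C + 1)), by positivity, fun u v hu hv hd => ?_⟩
    refine (hest u.1 v.1 u.2 v.2).trans ?_
    have h1 : C * ((psi μ p u.1 + psi μ p v.1) / 2 - psi μ p ((1 / 2 : ℝ) • (u.1 + v.1))) ≤ ε / 2 := by
      refine (mul_le_mul_of_nonneg_left hd hC).trans ?_
      rw [← mul_div_assoc, div_le_div_iff₀ (by positivity) (by positivity)]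
      nlinarith
    have h2 : rho μ p u.1 + rho μ p v.1 ≤ 2 * M * (|R| + 1) := by
      have a1 := h.rho_le_psi u.2
      have a2 := h.rho_le_psi v.2
      have a3 : M * psi μ p u.1 ≤ M * (|R| + 1) :=
        mul_le_mul_of_nonneg_left (by linarith [le_abs_self R]) hM.le
      have a4 : M * psi μ p v.1 ≤ M * (|R| + 1) :=
        mul_le_mul_of_nonneg_left (by linarith [le_abs_self R]) hM.le
      linarith
    have h3 : ε / (4 * M * (|R| + 1)) * (rho μ p u.1 + rho μ p v.1) ≤ ε / 2 := by
      refine (mul_le_mul_of_nonneg_left h2 (by positivity)).trans (le_of_eq ?_)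
      field_simp; norm_num
    linarith
  comp u hc := by
    obtain ⟨v, hv, hlim⟩ := h.complete (u := fun n => (u n).1) (fun n => (u n).2) hc
    exact ⟨⟨v, hv⟩, hlim⟩
  cont u l hl := h.cont_psi (fun n => (u n).2) l.2 hl
  contB u l a hl := h.cont_pair (fun n => (u n).2) l.2 a.2 hl
  grad u k := h.grad u.2 k.2

lemma int_mono (h : PQ μ p q m M) {u v : α → ℝ} (hu : MemVLp μ p u) (hv : MemVLp μ p v) :
    Integrable (fun x => (zOp p u x - zOp p v x) * (u x - v x)) μ :=
  h.int_mul (h.mem_sub hu hv) (h.symm.mem_sub (h.mem_z hu) (h.mem_z hv))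

lemma mono_nonneg (h : PQ μ p q m M) (u v : α → ℝ) :
    0 ≤ᵐ[μ] (fun x => (zOp p u x - zOp p v x) * (u x - v x)) := by
  filter_upwards [h.hc] with x hx
  have hm := zf_strictMono hx.lt
  show 0 ≤ (zf (p x) (u x) - zf (p x) (v x)) * (u x - v x)
  rcases le_total (u x) (v x) with h1 | h1
  · have := hm.monotone h1
    exact mul_nonneg_of_nonpos_of_nonpos (by linarith) (by linarith)
  · have := hm.monotone h1
    exact mul_nonneg (by linarith) (by linarith)

lemma strict (h : PQ μ p q m M) {u v : α → ℝ} (hu : MemVLp μ p u) (hv : MemVLp μ p v)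
    (hne : ¬ u =ᵐ[μ] v) : 0 < ∫ x, (zOp p u x - zOp p v x) * (u x - v x) ∂μ := by
  refine lt_of_le_of_ne (integral_nonneg_of_ae (h.mono_nonneg u v)) fun h0 => hne ?_
  have h1 := (integral_eq_zero_iff_of_nonneg_ae (h.mono_nonneg u v) (h.int_mono hu hv)).1 h0.symm
  filter_upwards [h1, h.hc] with x hx hx2
  rcases mul_eq_zero.1 hx with h3 | h3
  · exact (zf_strictMono hx2.lt).injective (sub_eq_zero.1 h3)
  · linarith

lemma surj (h : PQ μ p q m M) (A : Set ((α → ℝ) × (α → ℝ)))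
    (hA1 : ∀ r ∈ A, MemVLp μ p r.1 ∧ MemVLp μ q r.2)
    (hA : ∀ s ∈ A, ∀ r ∈ A, 0 ≤ ∫ x, (s.2 x - r.2 x) * (s.1 x - r.1 x) ∂μ)
    (hmax : ∀ u ξ : α → ℝ, MemVLp μ p u → MemVLp μ q ξ →
      (∀ r ∈ A, 0 ≤ ∫ x, (ξ x - r.2 x) * (u x - r.1 x) ∂μ) → (u, ξ) ∈ A)
    (lam : ℝ) (hlam : 0 < lam) (f : α → ℝ) (hf : MemVLp μ q f) :
    ∃ s ∈ A, ∀ᵐ x ∂μ, s.2 x + lam * zOp p s.1 x = f x := by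
  set A' : Set (h.V × h.symm.V) := {r | (r.1.1, f + lam • r.2.1) ∈ A} with hA'
  obtain ⟨x0, y0, hmem, hle⟩ := abstract_surj h.B _ _ _ _ h.Z h.symm.Z h.half
    (by rw [h.B_flip]; exact h.symm.half)
    (by
      intro u ξ
      have i1 : Integrable (fun x => |u.1 x| ^ p x / p x + |ξ.1 x| ^ q x / q x) μ :=
        (h.int_psi u.2).add (h.symm.int_psi ξ.2)
      rw [B_apply, psi, psi, add_assoc, ← integral_add (h.int_psi u.2) (h.symm.int_psi ξ.2),
        ← integral_add (h.int_mul u.2 ξ.2) i1]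
      refine integral_nonneg_of_ae ?_
      filter_upwards [h.hc] with x hx
      have := Real.young_inequality (u.1 x) (-ξ.1 x) hx
      rw [abs_neg] at this
      show 0 ≤ ξ.1 x * u.1 x + (|u.1 x| ^ p x / p x + |ξ.1 x| ^ q x / q x)
      linarith)
    (fun u v => integral_nonneg_of_ae (h.mono_nonneg u.1 v.1))
    (by
      intro u ξ
      rw [B_apply, B_apply, ← integral_neg]
      refine integral_congr_ae ?_
      filter_upwards [h.hc] with x hx
      show zf (p x) (-(zf (q x) (ξ.1 x))) * u.1 x = - (ξ.1 x * u.1 x)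
      rw [zf_neg, zf_inv hx]; ring)
    A'
    (by
      intro s hs r hr
      have h1 := hA _ hs _ hr
      have h2 : ∫ x, ((f + lam • s.2.1) x - (f + lam • r.2.1) x) * (s.1.1 x - r.1.1 x) ∂μ =
          lam * h.B (s.1 - r.1) (s.2 - r.2) := by
        rw [B_apply, ← integral_const_mul]
        congr 1; ext x
        simp only [Pi.add_apply, Pi.smul_apply, smul_eq_mul, Submodule.coe_sub, Pi.sub_apply]
        ring
      simp only at h1
      rw [h2] at h1
      exact nonneg_of_mul_nonneg_right h1 hlam)
    (by
      intro u ξ hall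
      refine hmax _ _ u.2 (h.symm.mem_add hf (h.symm.mem_smul lam ξ.2)) fun r hr => ?_
      obtain ⟨hr1, hr2⟩ := hA1 r hr
      have hm2 : MemVLp μ q (lam⁻¹ • (r.2 - f)) := h.symm.mem_smul _ (h.symm.mem_sub hr2 hf)
      have hr' : ((⟨r.1, hr1⟩, ⟨lam⁻¹ • (r.2 - f), hm2⟩) : h.V × h.symm.V) ∈ A' := by
        show (r.1, f + lam • (lam⁻¹ • (r.2 - f))) ∈ A
        rw [smul_inv_smul₀ hlam.ne', add_sub_cancel]
        exact hr
      have h1 := mul_nonneg hlam.le (hall _ hr')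
      rw [B_apply, ← integral_const_mul] at h1
      refine h1.trans (le_of_eq ?_)
      congr 1; ext x
      simp only [Pi.add_apply, Pi.smul_apply, smul_eq_mul, Submodule.coe_sub, Pi.sub_apply]
      field_simp
      ring)
  refine ⟨_, hmem, ?_⟩
  have heq : x0.1 =ᵐ[μ] y0.1 := by
    by_contra hne
    exact absurd (h.strict x0.2 y0.2 hne) (not_lt.2 hle)
  filter_upwards [heq] with x hx
  show f x + lam * (-(zf (p x) (x0.1 x))) + lam * zf (p x) (y0.1 x) = f x
  rw [hx]; ring

/-! Luxemburg norm -/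

lemma lux_nonneg (u : α → ℝ) : 0 ≤ luxNorm μ p u :=
  Real.sInf_nonneg fun _ hx => hx.1.le

lemma div_eq (u : α → ℝ) (c : ℝ) : (fun x => u x / c) = c⁻¹ • u := by
  ext x; simp [div_eq_inv_mul]

lemma lux_set (h : PQ μ p q m M) {u : α → ℝ} (hu : MemVLp μ p u) (c : ℝ) :
    vModular μ p (fun x => u x / c) ≤ 1 ↔ rho μ p (c⁻¹ • u) ≤ 1 := by
  rw [div_eq, h.mod_eq (h.mem_smul _ hu), ENNReal.ofReal_le_one]

lemma lux_le (h : PQ μ p q m M) {u : α → ℝ} (hu : MemVLp μ p u) {c : ℝ} (hc : 0 < c)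
    (h1 : rho μ p (c⁻¹ • u) ≤ 1) : luxNorm μ p u ≤ c :=
  csInf_le ⟨0, fun _ hx => hx.1.le⟩ ⟨hc, (h.lux_set hu c).2 h1⟩

lemma lux_le' (h : PQ μ p q m M) {u : α → ℝ} (hu : MemVLp μ p u) {c : ℝ} (hc : 1 ≤ c)
    (h1 : rho μ p u ≤ c) : rho μ p (c⁻¹ • u) ≤ 1 := by
  have hc0 : 0 < c := by linarith
  refine (h.rho_smul_le_self (by positivity) (inv_le_one_of_one_le₀ hc) hu).trans ?_
  rw [inv_mul_le_iff₀ hc0]; linarith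

lemma lux_lt (h : PQ μ p q m M) {u : α → ℝ} (hu : MemVLp μ p u) {d : ℝ}
    (hd : luxNorm μ p u < d) : rho μ p (d⁻¹ • u) ≤ 1 := by
  have hne : {lam : ℝ | 0 < lam ∧ vModular μ p (fun x => u x / lam) ≤ 1}.Nonempty :=
    ⟨max 1 (rho μ p u), by positivity,
      (h.lux_set hu _).2 (h.lux_le' hu (le_max_left _ _) (le_max_right _ _))⟩
  obtain ⟨c, ⟨hc, hc1⟩, hcd⟩ := exists_lt_of_csInf_lt hne hd
  rw [h.lux_set hu] at hc1
  have hd0 : 0 < d := hc.trans hcd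
  have e : d⁻¹ • u = (c / d) • (c⁻¹ • u) := by
    rw [smul_smul]; congr 1; field_simp
  have hcd1 : c / d ≤ 1 := by rw [div_le_one hd0]; exact hcd.le
  rw [e]
  refine (h.rho_smul_le_self (by positivity) hcd1 (h.mem_smul _ hu)).trans ?_
  have : 0 < c / d := by positivity
  have h0 : 0 ≤ rho μ p (c⁻¹ • u) := rho_nonneg _
  nlinarith

lemma rho_tendsto (h : PQ μ p q m M) {u : ℕ → α → ℝ} (hu : ∀ n, MemVLp μ p (u n))
    (hl : Tendsto (fun n => luxNorm μ p (u n)) atTop (𝓝 0)) :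
    Tendsto (fun n => rho μ p (u n)) atTop (𝓝 0) := by
  rw [Metric.tendsto_atTop]
  intro ε hε
  set d := min 1 (ε / 2) with hd
  have hd0 : 0 < d := by positivity
  obtain ⟨N, hN⟩ := eventually_atTop.1 (hl.eventually_lt_const hd0)
  refine ⟨N, fun n hn => ?_⟩
  rw [Real.dist_eq, sub_zero, abs_of_nonneg (rho_nonneg _)]
  have h1 := h.lux_lt (hu n) (hN n hn)
  have h2 := h.rho_smul_le_self hd0 (min_le_left _ _) (h.mem_smul d⁻¹ (hu n))
  rw [smul_inv_smul₀ hd0.ne'] at h2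
  have h3 : d ≤ ε / 2 := min_le_right _ _
  nlinarith

lemma lux_tendsto (h : PQ μ p q m M) {u : ℕ → α → ℝ} (hu : ∀ n, MemVLp μ p (u n))
    (hl : Tendsto (fun n => rho μ p (u n)) atTop (𝓝 0)) :
    Tendsto (fun n => luxNorm μ p (u n)) atTop (𝓝 0) := by
  rw [Metric.tendsto_atTop]
  intro ε hε
  set d := min 1 (ε / 2) with hd
  have hd0 : 0 < d := by positivity
  have hpos : 0 < (d⁻¹) ^ M := by positivity
  obtain ⟨N, hN⟩ := eventually_atTop.1 (hl.eventually_lt_const (inv_pos.2 hpos))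
  refine ⟨N, fun n hn => ?_⟩
  rw [Real.dist_eq, sub_zero, abs_of_nonneg (lux_nonneg _)]
  have h3 : d ≤ ε / 2 := min_le_right _ _
  have : luxNorm μ p (u n) ≤ d := by
    refine h.lux_le (hu n) hd0 ?_
    refine (h.rho_smul_le' ((one_le_inv₀ hd0).2 (min_le_left _ _)) (hu n)).trans ?_
    have := mul_le_mul_of_nonneg_left (hN n hn).le hpos.le
    rwa [mul_inv_cancel₀ hpos.ne'] at this
  linarith

lemma bounded (h : PQ μ p q m M) (R : ℝ) : ∃ C : ℝ, ∀ v : α → ℝ, MemVLp μ p v →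
    luxNorm μ p v ≤ R → luxNorm μ q (zOp p v) ≤ C := by
  have hM : 0 ≤ M := by linarith [h.h1, h.hmM]
  set d := |R| + 1 with hd
  have hd1 : 1 ≤ d := by simp [hd]
  have hd0 : 0 < d := by linarith
  have hC : 1 ≤ d ^ M := Real.one_le_rpow hd1 hM
  refine ⟨d ^ M, fun v hv hR => ?_⟩
  have h1 := h.lux_lt hv (show luxNorm μ p v < d by linarith [le_abs_self R])
  have h2 := h.rho_smul_le' hd1 (h.mem_smul d⁻¹ hv)
  rw [smul_inv_smul₀ hd0.ne'] at h2
  refine h.symm.lux_le (h.mem_z hv) (by linarith) (h.symm.lux_le' (h.mem_z hv) hC ?_)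
  rw [h.rho_z]
  nlinarith

lemma coercive (h : PQ μ p q m M) (K : ℝ) : ∃ R : ℝ, ∀ u : α → ℝ, MemVLp μ p u →
    R ≤ luxNorm μ p u → K * luxNorm μ p u ≤ ∫ x, zOp p u x * u x ∂μ := by
  have hm := h.h1
  have ht : Tendsto (fun t : ℝ => t ^ (m - 1)) atTop atTop := tendsto_rpow_atTop (by linarith)
  obtain ⟨T, hT⟩ := eventually_atTop.1 (ht.eventually_ge_atTop (2 * K))
  refine ⟨2 * max 1 T, fun u hu hR => ?_⟩
  set L := luxNorm μ p u with hL
  have hT1 : T ≤ L / 2 := by linarith [le_max_right 1 T]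
  have h1 : 1 ≤ L / 2 := by linarith [le_max_left 1 T]
  have hc0 : 0 < L / 2 := by linarith
  have hint : ∫ x, zOp p u x * u x ∂μ = rho μ p u := by
    refine integral_congr_ae ?_
    filter_upwards [h.hc] with x hx
    exact zf_mul_self hx.lt
  rw [hint]
  have h2 : 1 < rho μ p ((L / 2)⁻¹ • u) := by
    by_contra hcon
    have := h.lux_le hu hc0 (not_lt.1 hcon)
    linarith
  have h3 := h.rho_smul_le (inv_pos.2 hc0) (inv_le_one_of_one_le₀ h1) hu
  have hpos : 0 < (L / 2) ^ m := by positivity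
  rw [Real.inv_rpow hc0.le] at h3
  have h4 : (L / 2) ^ m ≤ rho μ p u := by
    have := h2.le.trans h3
    rw [inv_mul_eq_div, le_div_iff₀ hpos] at this
    linarith
  have h5 : (L / 2) ^ m = (L / 2) ^ (m - 1) * (L / 2) := by
    nth_rewrite 3 [← Real.rpow_one (L / 2)]
    rw [← Real.rpow_add hc0]; congr 1; ring
  have h6 := mul_le_mul_of_nonneg_right (hT _ hT1) hc0.le
  linarith

end PQ

lemma mkPQ {α : Type*} [MeasurableSpace α] {μ : Measure α}
    (p : α → ℝ) (hp : Measurable p) (pm pp : ℝ) (h1 : 1 < pm) (hmp : pm ≤ pp)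
    (hae : ∀ᵐ x ∂μ, pm ≤ p x ∧ p x ≤ pp) :
    PQ μ p (fun x => p x / (p x - 1)) (min pm (pp / (pp - 1))) (max pp (pm / (pm - 1))) where
  hp := hp
  hq := hp.div (hp.sub_const 1)
  h1 := by
    refine lt_min h1 ?_
    rw [lt_div_iff₀ (by linarith)]; linarith
  hmM := (min_le_left _ _).trans (hmp.trans (le_max_left _ _))
  hpa := by
    filter_upwards [hae] with x hx
    exact ⟨(min_le_left _ _).trans hx.1, hx.2.trans (le_max_left _ _)⟩
  hqa := by
    filter_upwards [hae] with x hx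
    refine ⟨(min_le_right _ _).trans ?_, le_trans ?_ (le_max_right _ _)⟩
    · rw [div_le_div_iff₀ (by linarith) (by linarith)]; linarith
    · rw [div_le_div_iff₀ (by linarith) (by linarith)]; linarith
  hc := by
    filter_upwards [hae] with x hx
    exact Real.HolderConjugate.conjExponent (by linarith)

/-- `Z_Ω : v ↦ |v|^{p(x)-2}v` is strictly monotone, bounded, continuous and
coercive from `L^{p(x)}(Ω)` to `L^{p'(x)}(Ω)`; and for every maximal monotone operator `A`,
`A + λ Z_Ω` is surjective for every `λ > 0`. -/
theorem zOp_properties {N : ℕ} (Ω : Set (Fin N → ℝ)) (hΩ : MeasurableSet Ω)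
    (hfin : volume Ω < ⊤)
    (p : (Fin N → ℝ) → ℝ) (hp : Measurable p) (pm pp : ℝ) (h1 : 1 < pm) (hmp : pm ≤ pp)
    (hae : ∀ᵐ x ∂(volume.restrict Ω), pm ≤ p x ∧ p x ≤ pp) :
    (∀ u v : (Fin N → ℝ) → ℝ, MemVLp (volume.restrict Ω) p u →
       MemVLp (volume.restrict Ω) p v → ¬ u =ᵐ[volume.restrict Ω] v →
       0 < ∫ x, (zOp p u x - zOp p v x) * (u x - v x) ∂(volume.restrict Ω)) ∧
    (∀ R : ℝ, ∃ C : ℝ, ∀ v : (Fin N → ℝ) → ℝ, MemVLp (volume.restrict Ω) p v →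
       luxNorm (volume.restrict Ω) p v ≤ R →
       luxNorm (volume.restrict Ω) (fun x => p x / (p x - 1)) (zOp p v) ≤ C) ∧
    (∀ (u : (Fin N → ℝ) → ℝ) (s : ℕ → (Fin N → ℝ) → ℝ),
       MemVLp (volume.restrict Ω) p u → (∀ n, MemVLp (volume.restrict Ω) p (s n)) →
       Tendsto (fun n => luxNorm (volume.restrict Ω) p fun x => s n x - u x) atTop (𝓝 0) →
       Tendsto (fun n => luxNorm (volume.restrict Ω) (fun x => p x / (p x - 1))
         fun x => zOp p (s n) x - zOp p u x) atTop (𝓝 0)) ∧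
    (∀ M : ℝ, ∃ R : ℝ, ∀ u : (Fin N → ℝ) → ℝ, MemVLp (volume.restrict Ω) p u →
       R ≤ luxNorm (volume.restrict Ω) p u →
       M * luxNorm (volume.restrict Ω) p u ≤ ∫ x, zOp p u x * u x ∂(volume.restrict Ω)) ∧
    (∀ A : Set (((Fin N → ℝ) → ℝ) × ((Fin N → ℝ) → ℝ)),
       (∀ q ∈ A, MemVLp (volume.restrict Ω) p q.1 ∧
          MemVLp (volume.restrict Ω) (fun x => p x / (p x - 1)) q.2) →
       (∀ q ∈ A, ∀ r ∈ A,
          0 ≤ ∫ x, (q.2 x - r.2 x) * (q.1 x - r.1 x) ∂(volume.restrict Ω)) →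
       (∀ u ξ : (Fin N → ℝ) → ℝ, MemVLp (volume.restrict Ω) p u →
          MemVLp (volume.restrict Ω) (fun x => p x / (p x - 1)) ξ →
          (∀ r ∈ A, 0 ≤ ∫ x, (ξ x - r.2 x) * (u x - r.1 x) ∂(volume.restrict Ω)) →
          (u, ξ) ∈ A) →
       ∀ lam : ℝ, 0 < lam →
         ∀ f : (Fin N → ℝ) → ℝ, MemVLp (volume.restrict Ω) (fun x => p x / (p x - 1)) f →
           ∃ q ∈ A, ∀ᵐ x ∂(volume.restrict Ω), q.2 x + lam * zOp p q.1 x = f x) := by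
  have h := mkPQ (μ := volume.restrict Ω) p hp pm pp h1 hmp hae
  refine ⟨fun u v hu hv hne => h.strict hu hv hne, h.bounded, ?_, h.coercive, ?_⟩
  · intro u s hu hs hl
    exact h.symm.lux_tendsto (fun n => h.symm.mem_sub (h.mem_z (hs n)) (h.mem_z hu))
      (h.cont_z hs hu (h.rho_tendsto (fun n => h.mem_sub (hs n) hu) hl))
  · intro A hA1 hA hmax lam hlam f hf
    exact h.surj A hA1 hA hmax lam hlam f hf
end
end

section
/- Let $\Omega \subseteq \mathbb{R}^N$ have finite measure, $Q = \Omega \times (0,T)$, $p$ with $1 < p^- \leq p^+ < \infty$, $V = L^{p(x)}(\Omega)$, $\mathcal{V} = L^{p(x)}(Q)$. Let $\varphi : V \to [0,\infty]$ be proper, lsc, convex with $0 \in D(\varphi)$, and define $\Phi : \mathcal{V} \to [0,\infty]$ by $\Phi(u) = \int_0^T \varphi(Pu(t))\,dt$ if $t \mapsto \varphi(Pu(t)) \in L^1(0,T)$ and $\Phi(u) = \infty$ otherwise. Then for $u \in \mathcal{V}$ and $\xi \in \mathcal{V}^*$: $\xi \in \partial_Q\Phi(u)$ if and only if $P\xi(t)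 \in \partial_\Omega\varphi(Pu(t))$ for a.e. $t \in (0,T)$. -/
open MeasureTheory Filter Set
open scoped ENNReal Topology

noncomputable section

/-- The product measure on the space-time cylinder `Ω × (0,T)`. -/
def QTmeas {N : ℕ} (Ω : Set (Fin N → ℝ)) (T : ℝ) : Measure ((Fin N → ℝ) × ℝ) :=
  (volume.restrict Ω).prod (volume.restrict (Set.Ioo (0:ℝ) T))


/-- Signed power. -/
def spow (q a : ℝ) : ℝ := if 0 ≤ a then a ^ q else -((-a) ^ q)

lemma abs_spow (q a : ℝ) : |spow q a| = |a| ^ q := by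
  unfold spow
  split_ifs with h
  · rw [abs_of_nonneg h, abs_of_nonneg (Real.rpow_nonneg h q)]
  · push Not at h
    rw [abs_neg, abs_of_neg h, abs_of_nonneg (Real.rpow_nonneg (by linarith) q)]

lemma add_rpow_le_aux {q a b : ℝ} (hq : 1 ≤ q) (ha : 0 ≤ a) (hb : 0 ≤ b) :
    (a + b) ^ q ≤ 2 ^ q * (a ^ q + b ^ q) := by
  have h0 : 0 ≤ q := by linarith
  have ha' := Real.rpow_nonneg ha q
  have hb' := Real.rpow_nonneg hb q
  have h2 : (0:ℝ) ≤ 2 ^ q := by positivity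
  rcases le_total a b with h | h
  · calc (a + b) ^ q ≤ (2 * b) ^ q := Real.rpow_le_rpow (by linarith) (by linarith) h0
      _ = 2 ^ q * b ^ q := Real.mul_rpow (by norm_num) hb
      _ ≤ _ := by gcongr; linarith
  · calc (a + b) ^ q ≤ (2 * a) ^ q := Real.rpow_le_rpow (by linarith) (by linarith) h0
      _ = 2 ^ q * a ^ q := Real.mul_rpow (by norm_num) ha
      _ ≤ _ := by gcongr; linarith

lemma sub_rpow_aux {q a b : ℝ} (hq : 1 ≤ q) (ha : 0 ≤ a) (hb : 0 ≤ b) :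
    |a - b| ^ q ≤ 2 ^ q * |a ^ q - b ^ q| := by
  have h2 : (1:ℝ) ≤ 2 ^ q := Real.one_le_rpow (by norm_num) (by linarith)
  suffices |a - b| ^ q ≤ |a ^ q - b ^ q| by
    nlinarith [abs_nonneg (a ^ q - b ^ q)]
  rcases le_total a b with h | h
  · have := Real.add_rpow_le_rpow_add (p := q) (a := b - a) (b := a) (by linarith) ha hq
    rw [sub_add_cancel] at this
    rw [abs_sub_comm, abs_sub_comm (a ^ q), abs_of_nonneg (by linarith : 0 ≤ b - a)]
    exact le_trans (by linarith) (le_abs_self _)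
  · have := Real.add_rpow_le_rpow_add (p := q) (a := a - b) (b := b) (by linarith) hb hq
    rw [sub_add_cancel] at this
    rw [abs_of_nonneg (by linarith : 0 ≤ a - b)]
    exact le_trans (by linarith) (le_abs_self _)

lemma spow_ineq {q : ℝ} (hq : 1 ≤ q) (a b : ℝ) :
    |a - b| ^ q ≤ 2 ^ q * |spow q a - spow q b| := by
  unfold spow
  split_ifs with h h' h'
  · exact sub_rpow_aux hq h h'
  · push Not at h'
    have := add_rpow_le_aux hq h (by linarith : 0 ≤ -b)
    rw [abs_of_nonneg (by linarith : 0 ≤ a - b), sub_neg_eq_add,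
      abs_of_nonneg (add_nonneg (Real.rpow_nonneg h q) (Real.rpow_nonneg (by linarith) q))]
    simpa [sub_eq_add_neg] using this
  · push Not at h
    have := add_rpow_le_aux hq h' (by linarith : 0 ≤ -a)
    rw [abs_sub_comm, abs_sub_comm (-((-a) ^ q)), abs_of_nonneg (by linarith : 0 ≤ b - a),
      sub_neg_eq_add,
      abs_of_nonneg (add_nonneg (Real.rpow_nonneg h' q) (Real.rpow_nonneg (by linarith) q))]
    simpa [sub_eq_add_neg] using this
  · push Not at h h'
    have := sub_rpow_aux hq (by linarith : 0 ≤ -b) (by linarith : 0 ≤ -a)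
    convert this using 2
    · congr 1; ring
    · congr 1; ring

section
variable {α : Type*} [MeasurableSpace α] {μ : Measure α} {p : α → ℝ}

lemma aemeas_mod (hp : AEMeasurable p μ) {u : α → ℝ} (hu : AEMeasurable u μ) :
    AEMeasurable (fun x => ENNReal.ofReal (|u x| ^ p x)) μ := by
  have : AEMeasurable (fun x => |u x|) μ := by simpa [Real.norm_eq_abs] using hu.norm
  exact (this.pow hp).ennreal_ofReal

lemma vModular_congr {u v : α → ℝ} (h : u =ᵐ[μ] v) : vModular μ p u = vModular μ p v := by
  unfold vModular
  refine lintegral_congr_ae ?_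
  filter_upwards [h] with x hx
  rw [hx]

lemma MemVLp.congr {u v : α → ℝ} (hu : MemVLp μ p u) (h : u =ᵐ[μ] v) : MemVLp μ p v :=
  ⟨hu.1.congr h, by rw [← vModular_congr h]; exact hu.2⟩

lemma MemVLp.sub {pm pp : ℝ} (h1 : 1 < pm) (hp : AEMeasurable p μ)
    (hae : ∀ᵐ x ∂μ, pm ≤ p x ∧ p x ≤ pp) {u v : α → ℝ} (hu : MemVLp μ p u)
    (hv : MemVLp μ p v) : MemVLp μ p (fun x => u x - v x) := by
  refine ⟨hu.1.sub hv.1, ?_⟩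
  have : vModular μ p (fun x => u x - v x) ≤
      ENNReal.ofReal (2 ^ pp) * (vModular μ p u + vModular μ p v) := by
    unfold vModular
    rw [← lintegral_add_left' (aemeas_mod hp hu.1), ← lintegral_const_mul' _ _ (by simp)]
    refine lintegral_mono_ae ?_
    filter_upwards [hae] with x hx
    rw [← ENNReal.ofReal_add (by positivity) (by positivity), ← ENNReal.ofReal_mul (by positivity)]
    apply ENNReal.ofReal_le_ofReal
    have h1' : 1 ≤ p x := by linarith
    calc |u x - v x| ^ p x ≤ (|u x| + |v x|) ^ p x :=
          Real.rpow_le_rpow (abs_nonneg _) (abs_sub _ _) (by linarith)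
      _ ≤ 2 ^ p x * (|u x| ^ p x + |v x| ^ p x) :=
          add_rpow_le_aux h1' (abs_nonneg _) (abs_nonneg _)
      _ ≤ _ := by gcongr; norm_num; exact hx.2
  refine lt_of_le_of_lt this (ENNReal.mul_lt_top (by simp) (ENNReal.add_lt_top.2 ⟨hu.2, hv.2⟩))

lemma measurable_spow : Measurable (fun z : ℝ × ℝ => spow z.1 z.2) := by
  unfold spow
  refine Measurable.ite (measurableSet_le measurable_const measurable_snd) ?_ ?_
  · exact measurable_snd.pow measurable_fst
  · exact (measurable_snd.neg.pow measurable_fst).neg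

lemma integrable_spow (hp : AEMeasurable p μ) {u : α → ℝ} (hu : MemVLp μ p u) :
    Integrable (fun x => spow (p x) (u x)) μ := by
  refine ⟨(measurable_spow.comp_aemeasurable (hp.prodMk hu.1)).aestronglyMeasurable, ?_⟩
  rw [hasFiniteIntegral_iff_norm]
  simp only [Real.norm_eq_abs, abs_spow]
  exact hu.2

lemma exists_countable_modular_dense [IsSeparable μ] [SigmaFinite μ] {pm pp : ℝ} (h1 : 1 < pm)
    (hp : AEMeasurable p μ) (hae : ∀ᵐ x ∂μ, pm ≤ p x ∧ p x ≤ pp)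
    (S : Set (α → ℝ)) (hS : ∀ w ∈ S, MemVLp μ p w) (ψ : (α → ℝ) → ℝ) :
    ∃ D : Set (α → ℝ), D.Countable ∧ D ⊆ S ∧ ∀ w ∈ S, ∀ ε : ℝ, 0 < ε →
      ∃ d ∈ D, vModular μ p (fun x => d x - w x) < ENNReal.ofReal ε ∧ |ψ d - ψ w| < ε := by
  classical
  let F : S → Lp ℝ 1 μ × ℝ := fun w =>
    ((integrable_spow hp (hS w.1 w.2)).toL1 _, ψ w.1)
  have : SecondCountableTopology (Lp ℝ 1 μ) := by
    have : Fact ((1:ℝ≥0∞) ≠ ⊤) := ⟨by simp⟩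
    infer_instance
  obtain ⟨C, hCc, hCd⟩ := TopologicalSpace.exists_countable_dense (range F)
  have hch : ∀ y : range F, ∃ w : S, F w = y.1 := fun y => y.2
  choose g hg using hch
  refine ⟨(fun y => (g y).1) '' C, hCc.image _, ?_, ?_⟩
  · rintro _ ⟨y, _, rfl⟩; exact (g y).2
  · intro w hw ε hε
    have h2 : (0:ℝ) < 2 ^ pp := by positivity
    set δ : ℝ := min (ε / (2 ^ pp)) ε with hδ
    have hδ0 : 0 < δ := lt_min (by positivity) hε
    obtain ⟨y, hyC, hy⟩ := Metric.dense_iff.1 hCd ⟨F ⟨w, hw⟩, mem_range_self _⟩ δ hδ0 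
    refine ⟨_, ⟨y, ?_, rfl⟩, ?_⟩
    · exact hy
    have hd : dist (F (g y)) (F ⟨w, hw⟩) < δ := by
      rw [hg]; exact hyC
    rw [Prod.dist_eq, max_lt_iff] at hd
    obtain ⟨hd1, hd2⟩ := hd
    constructor
    · have he : edist (F (g y)).1 (F ⟨w, hw⟩).1 < ENNReal.ofReal δ := by
        rw [edist_dist]; exact (ENNReal.ofReal_lt_ofReal_iff hδ0).2 hd1
      rw [Integrable.edist_toL1_toL1] at he
      calc vModular μ p (fun x => (g y).1 x - w x)
          ≤ ∫⁻ x, ENNReal.ofReal (2 ^ pp) * edist (spow (p x) ((g y).1 x)) (spow (p x) (w x)) ∂μ := by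
            refine lintegral_mono_ae ?_
            filter_upwards [hae] with x hx
            rw [edist_dist, Real.dist_eq, ← ENNReal.ofReal_mul h2.le]
            apply ENNReal.ofReal_le_ofReal
            refine (spow_ineq (by linarith) _ _).trans ?_
            gcongr
            · norm_num
            · exact hx.2
        _ = ENNReal.ofReal (2 ^ pp) * ∫⁻ x, edist (spow (p x) ((g y).1 x)) (spow (p x) (w x)) ∂μ :=
            lintegral_const_mul' _ _ (by simp)
        _ < ENNReal.ofReal (2 ^ pp) * ENNReal.ofReal δ := by
            rw [ENNReal.mul_lt_mul_iff_right (by simpa using h2) (by simp)]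
            exact he
        _ ≤ ENNReal.ofReal ε := by
            rw [← ENNReal.ofReal_mul h2.le]
            apply ENNReal.ofReal_le_ofReal
            calc 2 ^ pp * δ ≤ 2 ^ pp * (ε / 2 ^ pp) := by gcongr; exact min_le_left _ _
              _ = ε := by field_simp
    · rw [Real.dist_eq] at hd2
      exact lt_of_lt_of_le hd2 (min_le_right _ _)

lemma luxNorm_tendsto {pm pp : ℝ} (h1 : 1 < pm) 
    (hae : ∀ᵐ x ∂μ, pm ≤ p x ∧ p x ≤ pp) (f : ℕ → α → ℝ)
    (hf : Tendsto (fun n => vModular μ p (f n)) atTop (𝓝 0)) :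
    Tendsto (fun n => luxNorm μ p (f n)) atTop (𝓝 0) := by
  have hnn : ∀ n, 0 ≤ luxNorm μ p (f n) := fun n => Real.sInf_nonneg fun x hx => hx.1.le
  rw [Metric.tendsto_atTop]
  intro ε hε
  set l : ℝ := min (ε / 2) 1 with hl
  have hl0 : 0 < l := lt_min (by linarith) one_pos
  have hl1 : l ≤ 1 := min_le_right _ _
  have hlp : (0:ℝ) < l ^ pp := by positivity
  have hev := hf.eventually (gt_mem_nhds (show (0:ℝ≥0∞) < ENNReal.ofReal (l ^ pp) by simpa using hlp))
  obtain ⟨n0, hn0⟩ := eventually_atTop.1 hev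
  refine ⟨n0, fun n hn => ?_⟩
  have hmem : vModular μ p (fun x => f n x / l) ≤ 1 := by
    calc vModular μ p (fun x => f n x / l)
        ≤ ∫⁻ x, ENNReal.ofReal ((l ^ pp)⁻¹) * ENNReal.ofReal (|f n x| ^ p x) ∂μ := by
          refine lintegral_mono_ae ?_
          filter_upwards [hae] with x hx
          rw [← ENNReal.ofReal_mul (by positivity)]
          apply ENNReal.ofReal_le_ofReal
          rw [abs_div, abs_of_pos hl0, Real.div_rpow (abs_nonneg _) hl0.le, div_eq_inv_mul]
          exact mul_le_mul_of_nonneg_right (inv_anti₀ hlp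
            (Real.rpow_le_rpow_of_exponent_ge hl0 hl1 hx.2)) (by positivity)
      _ = ENNReal.ofReal ((l ^ pp)⁻¹) * vModular μ p (f n) := lintegral_const_mul' _ _ (by simp)
      _ ≤ ENNReal.ofReal ((l ^ pp)⁻¹) * ENNReal.ofReal (l ^ pp) := by gcongr; exact (hn0 n hn).le
      _ = 1 := by rw [← ENNReal.ofReal_mul (by positivity), inv_mul_cancel₀ hlp.ne']; simp
  have : luxNorm μ p (f n) ≤ l := csInf_le ⟨0, fun x hx => hx.1.le⟩ ⟨hl0, hmem⟩
  rw [Real.dist_eq, sub_zero, abs_of_nonneg (hnn n)]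
  have := min_le_left (ε / 2) 1
  linarith

/-- Young's inequality with a parameter. -/
lemma young_param {q pp δ : ℝ} (hq : 1 < q) (hqp : q ≤ pp) (hδ : 0 < δ) (hδ1 : δ ≤ 1) (a b : ℝ) :
    |a * b| ≤ δ * |a| ^ (q / (q - 1)) + (δ ^ pp)⁻¹ * |b| ^ q := by
  have hc : (q / (q - 1)).HolderConjugate q := (Real.HolderConjugate.conjExponent hq).symm
  have hq' : 1 < q / (q - 1) := hc.lt
  have hy := Real.young_inequality (δ * |a|) (|b| / δ) hc
  have e : δ * |a| * (|b| / δ) = |a * b| := by rw [abs_mul]; field_simp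
  rw [e, abs_of_nonneg (by positivity : 0 ≤ δ * |a|), abs_of_nonneg (by positivity : 0 ≤ |b| / δ)] at hy
  have i1 : (δ * |a|) ^ (q / (q - 1)) / (q / (q - 1)) ≤ δ * |a| ^ (q / (q - 1)) := by
    refine (div_le_self (by positivity) hq'.le).trans ?_
    rw [Real.mul_rpow hδ.le (abs_nonneg _)]
    gcongr
    calc δ ^ (q / (q - 1)) ≤ δ ^ (1:ℝ) := Real.rpow_le_rpow_of_exponent_ge hδ hδ1 hq'.le
      _ = δ := Real.rpow_one _
  have i2 : (|b| / δ) ^ q / q ≤ (δ ^ pp)⁻¹ * |b| ^ q := by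
    refine (div_le_self (by positivity) hq.le).trans ?_
    rw [Real.div_rpow (abs_nonneg _) hδ.le, div_eq_inv_mul]
    exact mul_le_mul_of_nonneg_right (inv_anti₀ (by positivity)
      (Real.rpow_le_rpow_of_exponent_ge hδ hδ1 hqp)) (by positivity)
  linarith

lemma pair_lintegral_le {pm pp : ℝ} (h1 : 1 < pm) (hp : AEMeasurable p μ)
    (hae : ∀ᵐ x ∂μ, pm ≤ p x ∧ p x ≤ pp) {ξ f : α → ℝ} (hξ : AEMeasurable ξ μ)
    {δ : ℝ} (hδ : 0 < δ) (hδ1 : δ ≤ 1) :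
    ∫⁻ x, ENNReal.ofReal ‖ξ x * f x‖ ∂μ ≤
      ENNReal.ofReal δ * vModular μ (fun x => p x / (p x - 1)) ξ +
      ENNReal.ofReal ((δ ^ pp)⁻¹) * vModular μ p f := by
  unfold vModular
  have hp' : AEMeasurable (fun x => p x / (p x - 1)) μ := hp.div (hp.sub_const 1)
  rw [← lintegral_const_mul' _ _ (by simp), ← lintegral_const_mul' _ _ (by simp),
    ← lintegral_add_left' ((aemeas_mod hp' hξ).const_mul _)]
  refine lintegral_mono_ae ?_
  filter_upwards [hae] with x hx
  rw [← ENNReal.ofReal_mul (by positivity), ← ENNReal.ofReal_mul (by positivity),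
    ← ENNReal.ofReal_add (by positivity) (by positivity)]
  exact ENNReal.ofReal_le_ofReal (young_param (by linarith) hx.2 hδ hδ1 _ _)

lemma pair_integrable {pm pp : ℝ} (h1 : 1 < pm) (hp : AEMeasurable p μ)
    (hae : ∀ᵐ x ∂μ, pm ≤ p x ∧ p x ≤ pp) {ξ f : α → ℝ}
    (hξ : MemVLp μ (fun x => p x / (p x - 1)) ξ) (hf : MemVLp μ p f) :
    Integrable (fun x => ξ x * f x) μ := by
  refine ⟨(hξ.1.mul hf.1).aestronglyMeasurable, ?_⟩
  rw [hasFiniteIntegral_iff_norm]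
  refine lt_of_le_of_lt (pair_lintegral_le h1 hp hae hξ.1 one_pos le_rfl) ?_
  exact ENNReal.add_lt_top.2 ⟨ENNReal.mul_lt_top (by simp) hξ.2, ENNReal.mul_lt_top (by simp) hf.2⟩

lemma pair_small {pm pp : ℝ} (h1 : 1 < pm) (hp : AEMeasurable p μ)
    (hae : ∀ᵐ x ∂μ, pm ≤ p x ∧ p x ≤ pp) {ξ : α → ℝ}
    (hξ : MemVLp μ (fun x => p x / (p x - 1)) ξ) {ε : ℝ} (hε : 0 < ε) :
    ∃ η : ℝ, 0 < η ∧ ∀ f : α → ℝ, vModular μ p f < ENNReal.ofReal η →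
      |∫ x, ξ x * f x ∂μ| ≤ ε := by
  set K := vModular μ (fun x => p x / (p x - 1)) ξ with hK
  have hKt : K ≠ ⊤ := hξ.2.ne
  set δ : ℝ := min 1 (ε / 2 / (K.toReal + 1)) with hδdef
  have hK0 : 0 ≤ K.toReal := ENNReal.toReal_nonneg
  have hδ : 0 < δ := lt_min one_pos (by positivity)
  have hδ1 : δ ≤ 1 := min_le_left _ _
  have hδK : δ * K.toReal ≤ ε / 2 := by
    calc δ * K.toReal ≤ (ε / 2 / (K.toReal + 1)) * (K.toReal + 1) := by
          gcongr
          · exact min_le_right _ _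
          · linarith
      _ = ε / 2 := by field_simp
  have hdp : 0 < δ ^ pp := by positivity
  refine ⟨δ ^ pp * (ε / 2), by positivity, fun f hf => ?_⟩
  have hb : ∫⁻ x, ENNReal.ofReal ‖ξ x * f x‖ ∂μ ≤ ENNReal.ofReal ε := by
    refine (pair_lintegral_le (f := f) h1 hp hae hξ.1 hδ hδ1).trans ?_
    calc ENNReal.ofReal δ * K + ENNReal.ofReal ((δ ^ pp)⁻¹) * vModular μ p f
        ≤ ENNReal.ofReal δ * ENNReal.ofReal K.toReal +
          ENNReal.ofReal ((δ ^ pp)⁻¹) * ENNReal.ofReal (δ ^ pp * (ε / 2)) := by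
          rw [ENNReal.ofReal_toReal hKt]; gcongr
      _ ≤ ENNReal.ofReal (ε / 2) + ENNReal.ofReal (ε / 2) := by
          rw [← ENNReal.ofReal_mul hδ.le, ← ENNReal.ofReal_mul (by positivity)]
          gcongr
          apply le_of_eq; field_simp
      _ = ENNReal.ofReal ε := by
          rw [← ENNReal.ofReal_add (by positivity) (by positivity)]; congr 1; ring
  rw [← Real.norm_eq_abs]
  refine (norm_integral_le_lintegral_norm _).trans ?_
  exact ENNReal.toReal_le_of_le_ofReal hε.le hb


lemma phi_le_of_approx {pm pp : ℝ} (h1 : 1 < pm)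
    (hae : ∀ᵐ x ∂μ, pm ≤ p x ∧ p x ≤ pp) (φ : (α → ℝ) → ℝ≥0∞)
    (hlsc : ∀ (w : α → ℝ) (s : ℕ → α → ℝ),
      MemVLp μ p w → (∀ n, MemVLp μ p (s n)) →
      Tendsto (fun n => luxNorm μ p fun x => s n x - w x) atTop (𝓝 0) →
      φ w ≤ atTop.liminf fun n => φ (s n))
    {w : α → ℝ} (hw : MemVLp μ p w) (r : ℝ≥0∞)
    (h : ∀ n : ℕ, ∃ d, MemVLp μ p d ∧ φ d ≤ r ∧
      vModular μ p (fun x => d x - w x) < ENNReal.ofReal (1 / ((n:ℝ) + 1))) : φ w ≤ r := by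
  choose s hs1 hs2 hs3 using h
  have hT : Tendsto (fun n => vModular μ p (fun x => s n x - w x)) atTop (𝓝 0) := by
    have h0 : Tendsto (fun n : ℕ => ENNReal.ofReal (1 / ((n:ℝ) + 1))) atTop (𝓝 0) := by
      have := ENNReal.tendsto_ofReal (tendsto_one_div_add_atTop_nhds_zero_nat (𝕜 := ℝ))
      simpa using this
    exact tendsto_of_tendsto_of_tendsto_of_le_of_le tendsto_const_nhds h0
      (fun n => zero_le) (fun n => (hs3 n).le)
  refine (hlsc w s hw hs1 (luxNorm_tendsto h1 hae _ hT)).trans ?_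
  calc atTop.liminf (fun n => φ (s n)) ≤ atTop.liminf (fun _ : ℕ => r) :=
        liminf_le_liminf (Eventually.of_forall hs2)
    _ = r := liminf_const r

lemma phi_congr {pm pp : ℝ} (h1 : 1 < pm)
    (hae : ∀ᵐ x ∂μ, pm ≤ p x ∧ p x ≤ pp) (φ : (α → ℝ) → ℝ≥0∞)
    (hlsc : ∀ (w : α → ℝ) (s : ℕ → α → ℝ),
      MemVLp μ p w → (∀ n, MemVLp μ p (s n)) →
      Tendsto (fun n => luxNorm μ p fun x => s n x - w x) atTop (𝓝 0) →
      φ w ≤ atTop.liminf fun n => φ (s n))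
    {w v : α → ℝ} (hw : MemVLp μ p w) (hwv : w =ᵐ[μ] v) : φ w = φ v := by
  have key : ∀ w v : α → ℝ, MemVLp μ p w → w =ᵐ[μ] v → φ w ≤ φ v := by
    intro w v hw hwv
    refine phi_le_of_approx h1 hae φ hlsc hw _ fun n => ⟨v, hw.congr hwv, le_rfl, ?_⟩
    have : vModular μ p (fun x => v x - w x) = 0 := by
      have : vModular μ p (fun x => v x - w x) = ∫⁻ _, 0 ∂μ := by
        refine lintegral_congr_ae ?_
        filter_upwards [hwv, hae] with x hx hpx
        rw [hx, sub_self, abs_zero, Real.zero_rpow (by linarith [hpx.1])]; simp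
      simpa using this
    rw [this]
    simp only [ENNReal.ofReal_pos]; positivity
  exact le_antisymm (key w v hw hwv) (key v w (hw.congr hwv) hwv.symm)

end

section
variable {α β : Type*} [MeasurableSpace α] [MeasurableSpace β] {μ : Measure α} {ν : Measure β}
  [SFinite μ] [SFinite ν] {p : α → ℝ}

lemma ae_ae_swap {P : α × β → Prop} (h : ∀ᵐ z ∂μ.prod ν, P z) :
    ∀ᵐ t ∂ν, ∀ᵐ x ∂μ, P (x, t) := by
  have h' : ∀ᵐ z ∂ν.prod μ, P z.swap :=
    (Measure.measurePreserving_swap (μ := ν) (ν := μ)).quasiMeasurePreserving.ae h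
  exact Measure.ae_ae_of_ae_prod h'

lemma ae_fst {P : α → Prop} (h : ∀ᵐ x ∂μ, P x) : ∀ᵐ z ∂μ.prod ν, P z.1 :=
  Measure.quasiMeasurePreserving_fst.ae h

lemma MemVLp.slice (hp : AEMeasurable p μ) {u : α × β → ℝ}
    (hu : MemVLp (μ.prod ν) (fun z => p z.1) u) :
    ∀ᵐ t ∂ν, MemVLp μ p (fun x => u (x, t)) := by
  have hp2 : AEMeasurable (fun z : α × β => p z.1) (μ.prod ν) :=
    hp.comp_quasiMeasurePreserving Measure.quasiMeasurePreserving_fst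
  have hm := aemeas_mod hp2 hu.1
  have h2 := hu.2
  unfold vModular at h2
  rw [lintegral_prod_symm _ hm] at h2
  have hA : AEMeasurable (fun t => ∫⁻ x, ENNReal.ofReal (|u (x, t)| ^ p x) ∂μ) ν :=
    AEMeasurable.lintegral_prod_left (f := fun x t => ENNReal.ofReal (|u (x, t)| ^ p x)) hm
  filter_upwards [ae_lt_top' hA h2.ne, ae_ae_swap hu.1.ae_eq_mk] with t ht1 ht2
  refine ⟨?_, ht1⟩
  exact ⟨fun x => hu.1.mk u (x, t), hu.1.measurable_mk.comp (measurable_id.prodMk measurable_const), ht2⟩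

lemma aemeasurable_phi [IsSeparable μ] [SigmaFinite μ] {pm pp : ℝ} (h1 : 1 < pm)
    (hp : Measurable p) (hae : ∀ᵐ x ∂μ, pm ≤ p x ∧ p x ≤ pp) (φ : (α → ℝ) → ℝ≥0∞)
    (hlsc : ∀ (w : α → ℝ) (s : ℕ → α → ℝ),
      MemVLp μ p w → (∀ n, MemVLp μ p (s n)) →
      Tendsto (fun n => luxNorm μ p fun x => s n x - w x) atTop (𝓝 0) →
      φ w ≤ atTop.liminf fun n => φ (s n))
    {u : α × β → ℝ} (hu : MemVLp (μ.prod ν) (fun z => p z.1) u) :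
    AEMeasurable (fun t => φ fun x => u (x, t)) ν := by
  classical
  set g : α × β → ℝ := hu.1.mk u with hg
  have hgm : Measurable g := hu.1.measurable_mk
  have hmod : ∀ d : α → ℝ, Measurable d →
      Measurable (fun t => vModular μ p (fun x => d x - g (x, t))) := by
    intro d hd
    refine Measurable.lintegral_prod_left
      (f := fun x t => ENNReal.ofReal (|d x - g (x, t)| ^ p x)) ?_
    have : Measurable (fun z : α × β => |d z.1 - g z|) := by
      have h3 : Measurable (fun z : α × β => d z.1 - g z) := (hd.comp measurable_fst).sub hgm
      simpa [Real.norm_eq_abs] using h3.norm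
    exact (this.pow (hp.comp measurable_fst)).ennreal_ofReal
  have hgs : ∀ t, Measurable (fun x => g (x, t)) := fun t =>
    hgm.comp (measurable_id.prodMk measurable_const)
  set E : Set β := {t | vModular μ p (fun x => g (x, t)) < ⊤} with hE
  have hEm : MeasurableSet E := by
    have := hmod (fun _ => 0) measurable_const
    have h2 : (fun t => vModular μ p (fun x => 0 - g (x, t))) =
        fun t => vModular μ p (fun x => g (x, t)) := by
      funext t; simp [vModular]
    rw [h2] at this
    exact measurableSet_lt this measurable_const
  have hmemE : ∀ t ∈ E, MemVLp μ p (fun x => g (x, t)) := fun t ht => ⟨(hgs t).aemeasurable, ht⟩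
  refine ⟨E.indicator (fun t => φ fun x => g (x, t)), ?_, ?_⟩
  · refine measurable_of_Iic fun r => ?_
    obtain ⟨D, hDc, hDS, hDd⟩ := exists_countable_modular_dense h1 hp.aemeasurable hae
      {w | Measurable w ∧ MemVLp μ p w ∧ φ w ≤ r} (fun w hw => hw.2.1) (fun _ => 0)
    have hset : (E.indicator (fun t => φ fun x => g (x, t))) ⁻¹' Iic r =
        Eᶜ ∪ (E ∩ ⋂ n : ℕ, ⋃ d ∈ D, {t | vModular μ p (fun x => d x - g (x, t)) <
          ENNReal.ofReal (1 / ((n:ℝ) + 1))}) := by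
      ext t
      by_cases ht : t ∈ E
      · simp only [mem_preimage, indicator_of_mem ht, mem_Iic, mem_union, mem_compl_iff, ht,
          not_true_eq_false, false_or, mem_inter_iff, true_and, mem_iInter, mem_iUnion,
          mem_ofPred_eq]
        constructor
        · intro h n
          obtain ⟨d, hd, hd1, _⟩ := hDd _ ⟨hgs t, hmemE t ht, h⟩ (1 / ((n:ℝ) + 1)) (by positivity)
          exact ⟨d, hd, hd1⟩
        · intro h
          refine phi_le_of_approx h1 hae φ hlsc (hmemE t ht) r fun n => ?_
          obtain ⟨d, hd, hd1⟩ := h n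
          exact ⟨d, (hDS hd).2.1, (hDS hd).2.2, hd1⟩
      · simp [ht]
    rw [hset]
    refine hEm.compl.union (hEm.inter (MeasurableSet.iInter fun n =>
      MeasurableSet.biUnion hDc fun d hd => ?_))
    exact measurableSet_lt (hmod d (hDS hd).1) measurable_const
  · filter_upwards [MemVLp.slice hp.aemeasurable hu, ae_ae_swap hu.1.ae_eq_mk] with t ht1 ht2
    have htE : t ∈ E := (ht1.congr ht2).2
    rw [indicator_of_mem htE]
    exact phi_congr h1 hae φ hlsc ht1 ht2

end

/-- characterization of the subdifferential of the time-integrated functional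
`Φ(u) = ∫_0^T φ(Pu(t)) dt` on `L^{p(x)}(Q)`: `ξ ∈ ∂_Q Φ(u)` iff
`Pξ(t) ∈ ∂_Ω φ(Pu(t))` for a.e. `t ∈ (0,T)`. -/
theorem subdifferential_extension {N : ℕ} (Ω : Set (Fin N → ℝ)) (hΩ : MeasurableSet Ω)
    (hfin : volume Ω < ⊤) (T : ℝ) (hT : 0 < T)
    (p : (Fin N → ℝ) → ℝ) (hp : Measurable p) (pm pp : ℝ) (h1 : 1 < pm) (hmp : pm ≤ pp)
    (hae : ∀ᵐ x ∂(volume.restrict Ω), pm ≤ p x ∧ p x ≤ pp)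
    (φ : ((Fin N → ℝ) → ℝ) → ℝ≥0∞)
    (hzero : φ 0 ≠ ⊤)
    (hlsc : ∀ (w : (Fin N → ℝ) → ℝ) (s : ℕ → (Fin N → ℝ) → ℝ),
      MemVLp (volume.restrict Ω) p w → (∀ n, MemVLp (volume.restrict Ω) p (s n)) →
      Tendsto (fun n => luxNorm (volume.restrict Ω) p fun x => s n x - w x) atTop (𝓝 0) →
      φ w ≤ atTop.liminf fun n => φ (s n))
    (hphiconv : ∀ w v, MemVLp (volume.restrict Ω) p w → MemVLp (volume.restrict Ω) p v →
      ∀ t : ℝ, 0 ≤ t → t ≤ 1 →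
      φ (fun x => t * w x + (1 - t) * v x) ≤
        ENNReal.ofReal t * φ w + ENNReal.ofReal (1 - t) * φ v)
    (u ξ : (Fin N → ℝ) × ℝ → ℝ)
    (hu : MemVLp (QTmeas Ω T) (fun z => p z.1) u)
    (hξ : MemVLp (QTmeas Ω T) (fun z => p z.1 / (p z.1 - 1)) ξ) :
    ((∫⁻ t in Set.Ioo (0:ℝ) T, φ fun x => u (x, t)) ≠ ⊤ ∧
      ∀ v : (Fin N → ℝ) × ℝ → ℝ, MemVLp (QTmeas Ω T) (fun z => p z.1) v →
        (∫⁻ t in Set.Ioo (0:ℝ) T, φ fun x => v (x, t)) ≠ ⊤ →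
        (∫ z, ξ z * (v z - u z) ∂(QTmeas Ω T)) ≤
          (∫⁻ t in Set.Ioo (0:ℝ) T, φ fun x => v (x, t)).toReal -
          (∫⁻ t in Set.Ioo (0:ℝ) T, φ fun x => u (x, t)).toReal)
    ↔ (∀ᵐ t ∂(volume.restrict (Set.Ioo (0:ℝ) T)),
        φ (fun x => u (x, t)) ≠ ⊤ ∧
        ∀ w : (Fin N → ℝ) → ℝ, MemVLp (volume.restrict Ω) p w → φ w ≠ ⊤ →
          (∫ x, ξ (x, t) * (w x - u (x, t)) ∂(volume.restrict Ω)) ≤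
            (φ w).toReal - (φ fun x => u (x, t)).toReal) := by
  classical
  unfold QTmeas at hu hξ ⊢
  set μ : Measure (Fin N → ℝ) := volume.restrict Ω with hμ
  set ν : Measure ℝ := volume.restrict (Set.Ioo (0:ℝ) T) with hν
  have hsep : IsSeparable μ := inferInstance
  have hpA : AEMeasurable p μ := hp.aemeasurable
  have hp2 : AEMeasurable (fun z : (Fin N → ℝ) × ℝ => p z.1) (μ.prod ν) :=
    (hp.comp measurable_fst).aemeasurable
  have hae2 : ∀ᵐ z ∂(μ.prod ν), pm ≤ p z.1 ∧ p z.1 ≤ pp := ae_fst hae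
  have hpairQ : ∀ v, MemVLp (μ.prod ν) (fun z => p z.1) v →
      Integrable (fun z => ξ z * (v z - u z)) (μ.prod ν) := fun v hv =>
    pair_integrable (p := fun z : (Fin N → ℝ) × ℝ => p z.1) h1 hp2 hae2 hξ
      (MemVLp.sub h1 hp2 hae2 hv hu)
  have hνfin : ν univ < ⊤ := measure_lt_top _ _
  constructor
  · rintro ⟨hfinu, hsub⟩
    have hφm : AEMeasurable (fun t => φ fun x => u (x, t)) ν :=
      aemeasurable_phi h1 hp hae φ hlsc hu
    have hφlt := ae_lt_top' hφm hfinu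
    have hφint := integrable_toReal_of_lintegral_ne_top hφm hfinu
    obtain ⟨D, hDc, hDS, hDd⟩ := exists_countable_modular_dense h1 hpA hae
      {w | MemVLp μ p w ∧ φ w ≠ ⊤} (fun w hw => hw.1) (fun w => (φ w).toReal)
    have hD : ∀ d ∈ D, ∀ᵐ t ∂ν, (∫ x, ξ (x, t) * (d x - u (x, t)) ∂μ) ≤
        (φ d).toReal - (φ fun x => u (x, t)).toReal := by
      intro d hd
      obtain ⟨hdm, hdφ⟩ := hDS hd
      have hdQ : MemVLp (μ.prod ν) (fun z => p z.1) (fun z => d z.1) := by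
        have hda : AEMeasurable (fun z : (Fin N → ℝ) × ℝ => d z.1) (μ.prod ν) :=
          hdm.1.comp_quasiMeasurePreserving Measure.quasiMeasurePreserving_fst
        refine ⟨hda, ?_⟩
        unfold vModular
        rw [lintegral_prod_symm _ (aemeas_mod hp2 hda)]
        simp only [lintegral_const]
        exact ENNReal.mul_lt_top hdm.2 hνfin
      have hI := hpairQ _ hdQ
      have hGi : Integrable (fun t => ∫ x, ξ (x, t) * (d x - u (x, t)) ∂μ) ν :=
        hI.integral_prod_right
      have hH : Integrable (fun t => (φ d).toReal - (φ fun x => u (x, t)).toReal -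
          ∫ x, ξ (x, t) * (d x - u (x, t)) ∂μ) ν := ((integrable_const _).sub hφint).sub hGi
      have hnn := ae_nonneg_of_forall_setIntegral_nonneg hH ?_
      · filter_upwards [hnn] with t ht
        simp only [Pi.zero_apply] at ht
        linarith
      intro A hA _
      set v : (Fin N → ℝ) × ℝ → ℝ := fun z => if z.2 ∈ A then d z.1 else u z with hv
      have hA2 : MeasurableSet {z : (Fin N → ℝ) × ℝ | z.2 ∈ A} := measurable_snd hA
      have hvQ : MemVLp (μ.prod ν) (fun z => p z.1) v := by
        refine ⟨?_, ?_⟩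
        · have h3 := (hdQ.1.indicator hA2).add (hu.1.indicator hA2.compl)
          refine h3.congr (Eventually.of_forall fun z => ?_)
          by_cases hz : z.2 ∈ A
          · simp [hv, hz]
          · simp [hv, hz]
        · refine lt_of_le_of_lt (b := vModular (μ.prod ν) (fun z => p z.1) (fun z => d z.1) +
            vModular (μ.prod ν) (fun z => p z.1) u) ?_ (ENNReal.add_lt_top.2 ⟨hdQ.2, hu.2⟩)
          unfold vModular
          rw [← lintegral_add_left' (aemeas_mod hp2 hdQ.1)]
          refine lintegral_mono fun z => ?_
          simp only [hv]
          split_ifs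
          · exact le_self_add
          · exact le_add_self
      have hΦv : (∫⁻ t, φ (fun x => v (x, t)) ∂ν) =
          φ d * ν A + ∫⁻ t in Aᶜ, φ (fun x => u (x, t)) ∂ν := by
        rw [← lintegral_add_compl _ hA]
        congr 1
        · rw [← setLIntegral_const]
          refine setLIntegral_congr_fun hA fun t ht => ?_
          simp only [hv, ht, if_true]
        · refine setLIntegral_congr_fun hA.compl fun t ht => ?_
          have ht' : t ∉ A := ht
          simp only [hv, ht', if_false]
      have hAt : φ d * ν A ≠ ⊤ :=
        (ENNReal.mul_lt_top hdφ.lt_top (measure_lt_top ν A)).ne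
      have hAct : (∫⁻ t in Aᶜ, φ (fun x => u (x, t)) ∂ν) ≠ ⊤ :=
        ne_top_of_le_ne_top hfinu (setLIntegral_le_lintegral _ _)
      have hAt' : (∫⁻ t in A, φ (fun x => u (x, t)) ∂ν) ≠ ⊤ :=
        ne_top_of_le_ne_top hfinu (setLIntegral_le_lintegral _ _)
      have hs := hsub v hvQ (by rw [hΦv]; exact ENNReal.add_ne_top.2 ⟨hAt, hAct⟩)
      rw [hΦv, ← lintegral_add_compl (μ := ν) (fun t => φ (fun x => u (x, t))) hA,
        ENNReal.toReal_add hAt hAct, ENNReal.toReal_add hAt' hAct,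
        integral_prod_symm _ (hpairQ v hvQ)] at hs
      have hGA : (∫ t, ∫ x, ξ (x, t) * (v (x, t) - u (x, t)) ∂μ ∂ν) =
          ∫ t in A, ∫ x, ξ (x, t) * (d x - u (x, t)) ∂μ ∂ν := by
        rw [← integral_indicator hA]
        congr 1
        funext t
        by_cases ht : t ∈ A
        · simp only [hv, ht, if_true, indicator_of_mem]
        · simp [hv, ht]
      rw [hGA] at hs
      have hCi : Integrable (fun t => (φ d).toReal - (φ fun x => u (x, t)).toReal) ν :=
        (integrable_const _).sub hφint
      rw [integral_sub hCi.integrableOn hGi.integrableOn,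
        integral_sub (integrable_const _) hφint.integrableOn,
        integral_toReal hφm.restrict (ae_restrict_of_ae hφlt)]
      rw [ENNReal.toReal_mul] at hs
      simp only [integral_const, smul_eq_mul, measureReal_def, Measure.restrict_apply_univ]
      linarith
    have hDall : ∀ᵐ t ∂ν, ∀ d ∈ D, (∫ x, ξ (x, t) * (d x - u (x, t)) ∂μ) ≤
        (φ d).toReal - (φ fun x => u (x, t)).toReal := (ae_ball_iff hDc).2 hD
    have hξs : ∀ᵐ t ∂ν, MemVLp μ (fun x => p x / (p x - 1)) (fun x => ξ (x, t)) :=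
      MemVLp.slice (p := fun x => p x / (p x - 1)) (hpA.div (hpA.sub_const 1)) hξ
    filter_upwards [hφlt, hDall, MemVLp.slice hpA hu, hξs] with t ht1 ht2 ht3 ht4
    refine ⟨ht1.ne, fun w hw hwφ => ?_⟩
    refine le_of_forall_pos_le_add fun ε hε => ?_
    obtain ⟨η, hη, hηs⟩ := pair_small h1 hpA hae ht4 (half_pos hε)
    obtain ⟨d, hd, hd1, hd2⟩ := hDd w ⟨hw, hwφ⟩ (min η (ε / 2)) (lt_min hη (half_pos hε))
    have hb := hηs _ (lt_of_lt_of_le hd1 (ENNReal.ofReal_le_ofReal (min_le_left _ _)))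
    have hd3 := lt_of_lt_of_le hd2 (min_le_right _ _)
    have hdm := (hDS hd).1
    have hsplit : (∫ x, ξ (x, t) * (d x - u (x, t)) ∂μ) =
        (∫ x, ξ (x, t) * (w x - u (x, t)) ∂μ) + ∫ x, ξ (x, t) * (d x - w x) ∂μ := by
      rw [← integral_add (pair_integrable h1 hpA hae ht4 (MemVLp.sub h1 hpA hae hw ht3))
        (pair_integrable h1 hpA hae ht4 (MemVLp.sub h1 hpA hae hdm hw))]
      congr 1
      funext x
      ring
    have := ht2 d hd
    rw [hsplit] at this
    rw [abs_le] at hb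
    rw [abs_lt] at hd3
    linarith [hb.1, hd3.2]
  · intro h
    have key : ∀ v, MemVLp (μ.prod ν) (fun z => p z.1) v →
        (∫⁻ t, φ (fun x => u (x, t)) ∂ν) +
          (∫⁻ t, ENNReal.ofReal (∫ x, ξ (x, t) * (v (x, t) - u (x, t)) ∂μ) ∂ν) ≤
        (∫⁻ t, φ (fun x => v (x, t)) ∂ν) +
          (∫⁻ t, ENNReal.ofReal (-∫ x, ξ (x, t) * (v (x, t) - u (x, t)) ∂μ) ∂ν) := by
      intro v hv
      have hGi : Integrable (fun t => ∫ x, ξ (x, t) * (v (x, t) - u (x, t)) ∂μ) ν :=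
        (hpairQ v hv).integral_prod_right
      have hGm := hGi.1.aemeasurable
      have hGm' : AEMeasurable (fun t => -∫ x, ξ (x, t) * (v (x, t) - u (x, t)) ∂μ) ν := hGm.neg
      rw [← lintegral_add_right' _ hGm.ennreal_ofReal,
        ← lintegral_add_right' _ hGm'.ennreal_ofReal]
      refine lintegral_mono_ae ?_
      filter_upwards [h, MemVLp.slice hpA hv] with t ht hvt
      by_cases hvφ : φ (fun x => v (x, t)) = ⊤
      · rw [hvφ]; simp
      have hs := ht.2 _ hvt hvφ
      set G := ∫ x, ξ (x, t) * (v (x, t) - u (x, t)) ∂μ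
      rw [← ENNReal.ofReal_toReal ht.1, ← ENNReal.ofReal_toReal hvφ]
      rcases le_total 0 G with hG | hG
      · rw [ENNReal.ofReal_of_nonpos (by linarith : -G ≤ 0), add_zero,
          ← ENNReal.ofReal_add ENNReal.toReal_nonneg hG]
        exact ENNReal.ofReal_le_ofReal (by linarith)
      · rw [ENNReal.ofReal_of_nonpos hG, add_zero]
        refine le_trans ?_ (ENNReal.ofReal_add ENNReal.toReal_nonneg (by simpa using hG)).le
        exact ENNReal.ofReal_le_ofReal (by
          show _ ≤ _ + -G
          linarith)
    have hfinite : ∀ v, MemVLp (μ.prod ν) (fun z => p z.1) v →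
        (∫⁻ t, ENNReal.ofReal (∫ x, ξ (x, t) * (v (x, t) - u (x, t)) ∂μ) ∂ν) ≠ ⊤ ∧
        (∫⁻ t, ENNReal.ofReal (-∫ x, ξ (x, t) * (v (x, t) - u (x, t)) ∂μ) ∂ν) ≠ ⊤ := by
      intro v hv
      have hGi : Integrable (fun t => ∫ x, ξ (x, t) * (v (x, t) - u (x, t)) ∂μ) ν :=
        (hpairQ v hv).integral_prod_right
      exact ⟨hGi.lintegral_lt_top.ne, hGi.neg.lintegral_lt_top.ne⟩
    have hfinu : (∫⁻ t, φ (fun x => u (x, t)) ∂ν) ≠ ⊤ := by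
      have h0 : MemVLp (μ.prod ν) (fun z => p z.1) (fun _ => 0) := by
        refine ⟨measurable_const.aemeasurable, ?_⟩
        have : vModular (μ.prod ν) (fun z => p z.1) (fun _ => 0) = ∫⁻ _, 0 ∂(μ.prod ν) := by
          refine lintegral_congr_ae ?_
          filter_upwards [hae2] with z hz
          rw [abs_zero, Real.zero_rpow (by linarith [hz.1])]; simp
        rw [this]; simp
      refine ne_top_of_le_ne_top ?_ (le_self_add.trans (key _ h0))
      refine ENNReal.add_ne_top.2 ⟨?_, (hfinite _ h0).2⟩
      rw [lintegral_const]
      exact (ENNReal.mul_lt_top (lt_top_iff_ne_top.2 hzero) hνfin).ne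
    refine ⟨hfinu, fun v hv hvφ => ?_⟩
    have hk := key v hv
    obtain ⟨hf1, hf2⟩ := hfinite v hv
    have hGi : Integrable (fun t => ∫ x, ξ (x, t) * (v (x, t) - u (x, t)) ∂μ) ν :=
      (hpairQ v hv).integral_prod_right
    rw [integral_prod_symm _ (hpairQ v hv),
      integral_eq_lintegral_pos_part_sub_lintegral_neg_part hGi]
    have hk' := ENNReal.toReal_mono (ENNReal.add_ne_top.2 ⟨hvφ, hf2⟩) hk
    rw [ENNReal.toReal_add hfinu hf1, ENNReal.toReal_add hvφ hf2] at hk'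
    linarith
end
end

section
/- Let $\Omega \subseteq \mathbb{R}^N$ be a domain with finite measure, $Q = \Omega\times(0,T)$, $p$ measurable with $1 < p^- \leq p^+ < \infty$, $V = L^{p(x)}(\Omega)$, $\mathcal{V} = L^{p(x)}(Q)$. Let $\phi : V \to [0,\infty]$ be proper, lower semicontinuous and convex, and define $\Phi : \mathcal{V} \to [0,\infty]$ by $\Phi(u) = \int_0^T \phi(Pu(t))\,dt$ if $Pu(t) \in D(\phi)$ a.e. and $t\mapsto\phi(Pu(t)) \in L^1(0,T)$, $\Phi(u) = \infty$ otherwise. Then $\Phi$ is lower semicontinuous on $\mathcal{V}$: if $u_n \to u$ strongly in $\mathcal{V}$ and $\Phi(u_n) \leq a$ for all $n$, then $\Phi(u) \leq a$. -/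
open MeasureTheory Filter Set
open scoped ENNReal Topology

noncomputable section

lemma vMod_scale {α : Type*} [MeasurableSpace α] {μ : Measure α} {p : α → ℝ}
    (h1 : ∀ᵐ x ∂μ, 1 ≤ p x) (f : α → ℝ) {l : ℝ} (h0 : 0 < l) (hl : l ≤ 1) :
    vModular μ p f ≤ ENNReal.ofReal l * vModular μ p (fun x => f x / l) := by
  unfold vModular
  rw [← lintegral_const_mul' _ _ ENNReal.ofReal_ne_top]
  apply lintegral_mono_ae
  filter_upwards [h1] with x hx
  rw [← ENNReal.ofReal_mul h0.le]
  apply ENNReal.ofReal_le_ofReal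
  rw [abs_div, abs_of_pos h0, Real.div_rpow (abs_nonneg _) h0.le]
  have h2 : l ^ p x ≤ l := by
    simpa using Real.rpow_le_rpow_of_exponent_ge h0 hl hx
  have h3 : 0 < l ^ p x := Real.rpow_pos_of_pos h0 _
  have h4 : 0 ≤ |f x| ^ p x := Real.rpow_nonneg (abs_nonneg _) _
  rw [mul_div_assoc', le_div_iff₀ h3, mul_comm l]
  exact mul_le_mul_of_nonneg_left h2 h4

lemma vMod_scale' {α : Type*} [MeasurableSpace α] {μ : Measure α} {p : α → ℝ} {pp : ℝ}
    (h1 : ∀ᵐ x ∂μ, p x ≤ pp) (f : α → ℝ) {l : ℝ} (h0 : 0 < l) (hl : l ≤ 1) :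
    vModular μ p (fun x => f x / l) ≤ ENNReal.ofReal ((l ^ pp)⁻¹) * vModular μ p f := by
  unfold vModular
  rw [← lintegral_const_mul' _ _ ENNReal.ofReal_ne_top]
  apply lintegral_mono_ae
  filter_upwards [h1] with x hx
  rw [← ENNReal.ofReal_mul (by positivity)]
  apply ENNReal.ofReal_le_ofReal
  rw [abs_div, abs_of_pos h0, Real.div_rpow (abs_nonneg _) h0.le, div_eq_inv_mul]
  have h2 : l ^ pp ≤ l ^ p x := Real.rpow_le_rpow_of_exponent_ge h0 hl hx
  have h3 : 0 < l ^ pp := Real.rpow_pos_of_pos h0 _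
  have h4 : 0 ≤ |f x| ^ p x := Real.rpow_nonneg (abs_nonneg _) _
  gcongr

lemma lux_set_nonempty {α : Type*} [MeasurableSpace α] {μ : Measure α} {p : α → ℝ}
    (h1 : ∀ᵐ x ∂μ, 1 ≤ p x) (f : α → ℝ) (hf : vModular μ p f < ⊤) :
    {lam : ℝ | 0 < lam ∧ vModular μ p (fun x => f x / lam) ≤ 1}.Nonempty := by
  set m := (vModular μ p f).toReal with hm
  have hm0 : 0 ≤ m := ENNReal.toReal_nonneg
  have hl : (0:ℝ) < 1 + m := by linarith
  refine ⟨1 + m, hl, ?_⟩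
  have := vMod_scale h1 (fun x => f x / (1 + m)) (l := (1 + m)⁻¹) (by positivity)
    (inv_le_one_of_one_le₀ (by linarith))
  refine this.trans ?_
  have e : (fun x => f x / (1 + m) / (1 + m)⁻¹) = f := by
    funext x; field_simp
  rw [e, ← ENNReal.ofReal_toReal hf.ne, ← ENNReal.ofReal_mul (by positivity), ← hm]
  rw [ENNReal.ofReal_le_one, inv_mul_le_iff₀ hl]
  linarith

lemma lux_nonneg {α : Type*} [MeasurableSpace α] {μ : Measure α} {p : α → ℝ} (f : α → ℝ) :
    0 ≤ luxNorm μ p f := Real.sInf_nonneg fun _ h => h.1.le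

lemma vMod_tendsto_of_lux {α : Type*} [MeasurableSpace α] {μ : Measure α} {p : α → ℝ}
    (h1 : ∀ᵐ x ∂μ, 1 ≤ p x) (f : ℕ → α → ℝ) (hf : ∀ n, vModular μ p (f n) < ⊤)
    (h : Tendsto (fun n => luxNorm μ p (f n)) atTop (𝓝 0)) :
    Tendsto (fun n => vModular μ p (f n)) atTop (𝓝 0) := by
  rw [ENNReal.tendsto_nhds_zero]
  intro e he
  obtain ⟨r, hr0, hr⟩ : ∃ r : ℝ, 0 < r ∧ ENNReal.ofReal r ≤ e := by
    rcases eq_or_ne e ⊤ with rfl | h'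
    · exact ⟨1, one_pos, le_top⟩
    · exact ⟨e.toReal, ENNReal.toReal_pos he.ne' h', ENNReal.ofReal_toReal_le⟩
  have hmin : 0 < min r 1 := lt_min hr0 one_pos
  filter_upwards [h.eventually (gt_mem_nhds hmin)] with n hn
  obtain ⟨l, ⟨hl0, hl⟩, hlt⟩ := exists_lt_of_csInf_lt (lux_set_nonempty h1 _ (hf n)) hn
  calc vModular μ p (f n) ≤ ENNReal.ofReal l * vModular μ p (fun x => f n x / l) :=
        vMod_scale h1 _ hl0 (hlt.le.trans (min_le_right _ _))
    _ ≤ ENNReal.ofReal l * 1 := by gcongr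
    _ ≤ e := by
      rw [mul_one]
      exact (ENNReal.ofReal_le_ofReal (hlt.le.trans (min_le_left _ _))).trans hr

lemma lux_tendsto_of_vMod {α : Type*} [MeasurableSpace α] {μ : Measure α} {p : α → ℝ} {pp : ℝ}
    (h1 : ∀ᵐ x ∂μ, p x ≤ pp) (f : ℕ → α → ℝ)
    (h : Tendsto (fun n => vModular μ p (f n)) atTop (𝓝 0)) :
    Tendsto (fun n => luxNorm μ p (f n)) atTop (𝓝 0) := by
  rw [Metric.tendsto_nhds]
  intro e he
  set r := min (e / 2) 1 with hr
  have hr0 : 0 < r := lt_min (by linarith) one_pos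
  have hrp : 0 < r ^ pp := Real.rpow_pos_of_pos hr0 _
  filter_upwards [h.eventually (gt_mem_nhds (ENNReal.ofReal_pos.2 hrp))] with n hn
  have : luxNorm μ p (f n) ≤ r := by
    refine csInf_le ⟨0, fun _ h => h.1.le⟩ ⟨hr0, ?_⟩
    refine (vMod_scale' h1 _ hr0 (min_le_right _ _)).trans ?_
    calc _ ≤ ENNReal.ofReal ((r ^ pp)⁻¹) * ENNReal.ofReal (r ^ pp) := by gcongr
      _ = 1 := by
        rw [← ENNReal.ofReal_mul (by positivity), inv_mul_cancel₀ hrp.ne', ENNReal.ofReal_one]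
  rw [Real.dist_eq, sub_zero, abs_of_nonneg (lux_nonneg _)]
  have : r ≤ e / 2 := min_le_left _ _
  linarith

/-- the Mazur map -/
def mz (p a : ℝ) : ℝ := SignType.sign a * |a| ^ p

lemma rpow_sub_le {p a b : ℝ} (hp : 1 ≤ p) (hb : 0 ≤ b) (hab : b ≤ a) :
    (a - b) ^ p ≤ a ^ p - b ^ p := by
  have := Real.add_rpow_le_rpow_add (a := a - b) (b := b) (by linarith) hb hp
  simp at this
  linarith

lemma rpow_add_le' {p a b : ℝ} (hp : 1 ≤ p) (ha : 0 ≤ a) (hb : 0 ≤ b) :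
    (a + b) ^ p ≤ 2 ^ p * (a ^ p + b ^ p) := by
  wlog h : b ≤ a generalizing a b
  · rw [add_comm a, add_comm (a ^ p)]
    exact this hb ha (by linarith)
  calc (a + b) ^ p ≤ (2 * a) ^ p := by
        apply Real.rpow_le_rpow <;> linarith
    _ = 2 ^ p * a ^ p := Real.mul_rpow (by norm_num) ha
    _ ≤ _ := by
      have := Real.rpow_nonneg hb p
      have := Real.rpow_nonneg (zero_le_two : (0:ℝ) ≤ 2) p
      gcongr; linarith

lemma mz_nonneg {p a : ℝ} (hp : 1 ≤ p) (h : 0 ≤ a) : mz p a = a ^ p := by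
  rcases h.eq_or_lt with rfl | h
  · simp [mz, Real.zero_rpow (by linarith : p ≠ 0)]
  · simp [mz, sign_pos h, abs_of_pos h]

lemma mz_neg {p a : ℝ} : mz p (-a) = - mz p a := by
  simp [mz, Left.sign_neg]

lemma abs_mz {p a : ℝ} (hp : 1 ≤ p) : |mz p a| = |a| ^ p := by
  rcases le_total 0 a with h | h
  · rw [mz_nonneg hp h, abs_of_nonneg h, abs_of_nonneg (Real.rpow_nonneg h _)]
  · have : 0 ≤ -a := by linarith
    rw [← neg_neg a, mz_neg, mz_nonneg hp this, abs_neg, abs_neg, abs_of_nonneg this,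
      abs_of_nonneg (Real.rpow_nonneg this _)]

lemma mz_ineq {p : ℝ} (a b : ℝ) (hp : 1 ≤ p) :
    |a - b| ^ p ≤ 2 ^ p * |mz p a - mz p b| := by
  wlog hab : b ≤ a generalizing a b
  · rw [abs_sub_comm a, abs_sub_comm (mz p a)]
    exact this b a (by linarith)
  have h2 : (1:ℝ) ≤ 2 ^ p := Real.one_le_rpow (by norm_num) (by linarith)
  have key : ∀ a b : ℝ, 0 ≤ b → b ≤ a → |a - b| ^ p ≤ 2 ^ p * |mz p a - mz p b| := by
    intro a b hb hab
    rw [mz_nonneg hp hb, mz_nonneg hp (hb.trans hab), abs_of_nonneg (sub_nonneg.2 hab)]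
    have := rpow_sub_le hp hb hab
    have h3 := le_abs_self (a ^ p - b ^ p)
    have h4 := abs_nonneg (a ^ p - b ^ p)
    nlinarith
  rcases le_total 0 b with hb | hb
  · exact key a b hb hab
  rcases le_total 0 a with ha | ha
  · have hb' : 0 ≤ -b := by linarith
    have e : mz p b = - (-b) ^ p := by
      rw [← mz_nonneg hp hb', mz_neg, neg_neg]
    rw [e, mz_nonneg hp ha, sub_neg_eq_add, abs_of_nonneg (sub_nonneg.2 hab),
      abs_of_nonneg (add_nonneg (Real.rpow_nonneg ha _) (Real.rpow_nonneg hb' _)), sub_eq_add_neg]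
    exact rpow_add_le' hp ha hb'
  · have := key (-b) (-a) (by linarith) (by linarith)
    rw [mz_neg, mz_neg] at this
    convert this using 3 <;> ring

lemma mz_inv {p : ℝ} (hp : 1 ≤ p) (a : ℝ) : mz p (mz p⁻¹ a) = a := by
  have key : ∀ a, 0 < a → mz p (mz p⁻¹ a) = a := by
    intro a h
    have : mz p⁻¹ a = a ^ p⁻¹ := by simp [mz, sign_pos h, abs_of_pos h]
    rw [this, mz_nonneg hp (by positivity), ← Real.rpow_mul h.le, inv_mul_cancel₀ (by linarith),
      Real.rpow_one]
  rcases lt_trichotomy a 0 with h | rfl | h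
  · have := key (-a) (by linarith)
    rwa [mz_neg, mz_neg, neg_inj] at this
  · simp [mz]
  · exact key a h

lemma measurable_sign_real : Measurable (fun a : ℝ => ((SignType.sign a : SignType) : ℝ)) := by
  have : (fun a : ℝ => ((SignType.sign a : SignType) : ℝ)) =
      fun a => if 0 < a then 1 else if a < 0 then -1 else 0 := by
    funext a
    rw [sign_apply]
    split_ifs <;> simp
  rw [this]
  exact Measurable.ite measurableSet_Ioi measurable_const
    (Measurable.ite measurableSet_Iio measurable_const measurable_const)

lemma measurable_mz {α : Type*} [MeasurableSpace α] {p f : α → ℝ} (hp : Measurable p)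
    (hf : Measurable f) : Measurable fun x => mz (p x) (f x) := by
  unfold mz
  refine (measurable_sign_real.comp hf).mul ?_
  have : Measurable fun x => |f x| := by simpa using hf.norm
  exact this.pow hp

lemma vMod_congr {α : Type*} [MeasurableSpace α] {μ : Measure α} {p : α → ℝ} {f g : α → ℝ}
    (h : f =ᵐ[μ] g) : vModular μ p f = vModular μ p g := by
  apply lintegral_congr_ae
  filter_upwards [h] with x hx
  rw [hx]

lemma vMod_zero {α : Type*} [MeasurableSpace α] {μ : Measure α} {p : α → ℝ}
    (h1 : ∀ᵐ x ∂μ, 1 ≤ p x) {f : α → ℝ}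
    (h : f =ᵐ[μ] 0) : vModular μ p f = 0 := by
  have : (0:ENNReal) = ∫⁻ x, 0 ∂μ := by simp
  rw [this]
  apply lintegral_congr_ae
  filter_upwards [h, h1] with x hx h1
  simp [hx, Real.zero_rpow (by linarith : p x ≠ 0)]

lemma vMod_sub {α : Type*} [MeasurableSpace α] {μ : Measure α} {p : α → ℝ} {pp : ℝ}
    (h1 : ∀ᵐ x ∂μ, 1 ≤ p x) (h2 : ∀ᵐ x ∂μ, p x ≤ pp) (hp : AEMeasurable p μ) {f g : α → ℝ}
    (hf : MemVLp μ p f) (hg : MemVLp μ p g) : vModular μ p (fun x => f x - g x) < ⊤ := by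
  have hm : AEMeasurable (fun x => ENNReal.ofReal (|f x| ^ p x)) μ := by
    have : AEMeasurable (fun x => |f x|) μ := by simpa using hf.1.norm
    exact (this.pow hp).ennreal_ofReal
  calc _ ≤ ∫⁻ x, ENNReal.ofReal (2 ^ pp) * (ENNReal.ofReal (|f x| ^ p x)
          + ENNReal.ofReal (|g x| ^ p x)) ∂μ := by
        apply lintegral_mono_ae
        filter_upwards [h1, h2] with x hx hx2
        have p1 : 0 ≤ |f x| ^ p x := Real.rpow_nonneg (abs_nonneg _) _
        have p2 : 0 ≤ |g x| ^ p x := Real.rpow_nonneg (abs_nonneg _) _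
        rw [← ENNReal.ofReal_add p1 p2, ← ENNReal.ofReal_mul (by positivity)]
        apply ENNReal.ofReal_le_ofReal
        calc |f x - g x| ^ p x ≤ (|f x| + |g x|) ^ p x :=
              Real.rpow_le_rpow (abs_nonneg _) (abs_sub _ _) (by linarith)
          _ ≤ 2 ^ p x * (|f x| ^ p x + |g x| ^ p x) :=
              rpow_add_le' hx (abs_nonneg _) (abs_nonneg _)
          _ ≤ _ := by
              gcongr
              norm_num
    _ < ⊤ := by
        rw [lintegral_const_mul' _ _ ENNReal.ofReal_ne_top, lintegral_add_left' hm]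
        exact ENNReal.mul_lt_top ENNReal.ofReal_lt_top (ENNReal.add_lt_top.2 ⟨hf.2, hg.2⟩)

section measurability

variable {α β : Type*} [MeasurableSpace α] [MeasurableSpace β] {μ : Measure α} {ν : Measure β}

lemma ae_swap [SFinite μ] [SFinite ν] {P : α × β → Prop} (h : ∀ᵐ z ∂(μ.prod ν), P z) :
    ∀ᵐ t ∂ν, ∀ᵐ x ∂μ, P (x, t) := by
  rw [← Measure.prod_swap] at h
  exact Measure.ae_ae_of_ae_prod (ae_of_ae_map measurable_swap.aemeasurable h)

lemma vMod_prod [SFinite μ] [SFinite ν] {p : α → ℝ} (hp : Measurable p) {f : α × β → ℝ}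
    (hf : AEMeasurable f (μ.prod ν)) :
    vModular (μ.prod ν) (fun z => p z.1) f = ∫⁻ t, vModular μ p (fun x => f (x, t)) ∂ν := by
  unfold vModular
  rw [lintegral_prod_symm]
  have : AEMeasurable (fun x => |f x|) (μ.prod ν) := by simpa using hf.norm
  exact (this.pow (hp.comp measurable_fst).aemeasurable).ennreal_ofReal

lemma memV_ae [SFinite μ] [SFinite ν] {p : α → ℝ} (hp : Measurable p) {f : α × β → ℝ}
    (hf : MemVLp (μ.prod ν) (fun z => p z.1) f) :
    ∀ᵐ t ∂ν, MemVLp μ p (fun x => f (x, t)) := by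
  have hm : AEMeasurable (fun z => ENNReal.ofReal (|f z| ^ p z.1)) (μ.prod ν) := by
    have : AEMeasurable (fun x => |f x|) (μ.prod ν) := by simpa using hf.1.norm
    exact (this.pow (hp.comp measurable_fst).aemeasurable).ennreal_ofReal
  have h2 := hf.2
  rw [vMod_prod hp hf.1] at h2
  have h3 : AEMeasurable (fun t => vModular μ p (fun x => f (x, t))) ν := by
    have := hm.prod_swap.lintegral_prod_right'
    exact this
  have h4 := ae_lt_top' h3 h2.ne
  have h5 := ae_swap hf.1.ae_eq_mk
  filter_upwards [h4, h5] with t ht ht2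
  refine ⟨⟨fun x => hf.1.mk f (x, t), hf.1.measurable_mk.comp measurable_prodMk_right, ht2⟩, ht⟩

lemma measurable_of_edist {E : Type*} [PseudoEMetricSpace E] [SecondCountableTopology E]
    [MeasurableSpace E] [BorelSpace E] {F : β → E}
    (h : ∀ e : E, Measurable fun t => edist (F t) e) : Measurable F := by
  refine measurable_of_isOpen fun U hU => ?_
  have : ∀ x : U, ∃ r > 0, Metric.eball x.1 r ⊆ U := fun x => EMetric.isOpen_iff.1 hU x.1 x.2
  choose r hr0 hr using this
  obtain ⟨S, hS, hSU⟩ := TopologicalSpace.isOpen_iUnion_countable (fun x : U => Metric.eball x.1 (r x))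
    (fun x => Metric.isOpen_eball)
  have hU' : U = ⋃ x ∈ S, Metric.eball x.1 (r x) := by
    rw [hSU]
    apply subset_antisymm
    · intro x hx
      exact mem_iUnion.2 ⟨⟨x, hx⟩, Metric.mem_eball_self (hr0 ⟨x, hx⟩)⟩
    · exact iUnion_subset hr
  rw [hU', preimage_iUnion₂]
  exact MeasurableSet.biUnion hS fun x _ => (h x.1) measurableSet_Iio

theorem phi_aemeasurable [SFinite μ] [SFinite ν] [IsSeparable μ] {p : α → ℝ} {pp : ℝ} (hp : Measurable p)
    (h1 : ∀ᵐ x ∂μ, 1 ≤ p x) (h2 : ∀ᵐ x ∂μ, p x ≤ pp)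
    (φ : (α → ℝ) → ℝ≥0∞)
    (hlsc : ∀ (w : α → ℝ) (s : ℕ → α → ℝ), MemVLp μ p w → (∀ n, MemVLp μ p (s n)) →
      Tendsto (fun n => luxNorm μ p fun x => s n x - w x) atTop (𝓝 0) →
      φ w ≤ atTop.liminf fun n => φ (s n))
    {f : α × β → ℝ} (hf : MemVLp (μ.prod ν) (fun z => p z.1) f) :
    AEMeasurable (fun t => φ fun x => f (x, t)) ν := by
  -- invariance under a.e. equality
  have hcongr1 : ∀ w v : α → ℝ, MemVLp μ p w → MemVLp μ p v → w =ᵐ[μ] v → φ w ≤ φ v := by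
    intro w v hw hv hwv
    have := hlsc w (fun _ => v) hw (fun _ => hv) ?_
    · simpa using this
    · apply lux_tendsto_of_vMod h2
      rw [vMod_zero h1]
      · exact tendsto_const_nhds
      · filter_upwards [hwv] with x hx
        simp [hx]
  have hcongr : ∀ w v : α → ℝ, MemVLp μ p w → MemVLp μ p v → w =ᵐ[μ] v → φ w = φ v :=
    fun w v hw hv h => le_antisymm (hcongr1 w v hw hv h) (hcongr1 v w hv hw h.symm)
  -- the transported functional on L1
  let J : (α →₁[μ] ℝ) → α → ℝ := fun g x => mz (p x)⁻¹ (g x)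
  have hJ : ∀ g, MemVLp μ p (J g) := by
    intro g
    have hgm : Measurable g := L1.measurable_coeFn g
    refine ⟨(measurable_mz hp.inv hgm).aemeasurable, ?_⟩
    have := L1.hasFiniteIntegral_coeFn g
    rw [hasFiniteIntegral_iff_norm] at this
    refine lt_of_eq_of_lt ?_ this
    apply lintegral_congr_ae
    filter_upwards [h1] with x hx
    simp only [J]
    rw [← abs_mz hx, mz_inv hx, Real.norm_eq_abs]
  have hψ : LowerSemicontinuous fun g => φ (J g) := by
    rw [lowerSemicontinuous_iff_isClosed_preimage]
    intro c
    apply IsSeqClosed.isClosed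
    intro gs g hgs hg
    refine (hlsc (J g) (fun n => J (gs n)) (hJ g) (fun n => hJ _) ?_).trans ?_
    · apply lux_tendsto_of_vMod h2
      have hd : Tendsto (fun n => edist (gs n) g) atTop (𝓝 0) := by
        rwa [tendsto_iff_edist_tendsto_0] at hg
      have hd2 : Tendsto (fun n => ENNReal.ofReal (2 ^ pp) * edist (gs n) g) atTop (𝓝 0) := by
        simpa using ENNReal.Tendsto.const_mul hd (Or.inr ENNReal.ofReal_ne_top)
      refine tendsto_of_tendsto_of_tendsto_of_le_of_le tendsto_const_nhds hd2
        (fun _ => zero_le) (fun n => ?_)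
      simp only
      rw [L1.edist_def, ← lintegral_const_mul' _ _ ENNReal.ofReal_ne_top]
      apply lintegral_mono_ae
      filter_upwards [h1, h2] with x hx hx2
      rw [edist_dist, ← ENNReal.ofReal_mul (by positivity)]
      apply ENNReal.ofReal_le_ofReal
      have := mz_ineq (J (gs n) x) (J g x) hx
      simp only [J, mz_inv hx] at this
      refine this.trans ?_
      rw [Real.dist_eq]
      gcongr
      norm_num
    · exact liminf_le_of_frequently_le' (Frequently.of_forall hgs)
  -- measurable representative
  obtain ⟨f', hf'm, hff'⟩ := hf.1
  have hf' : MemVLp (μ.prod ν) (fun z => p z.1) f' :=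
    ⟨hf'm.aemeasurable, by rw [← vMod_congr hff']; exact hf.2⟩
  have hM : Measurable fun t => vModular μ p (fun x => f' (x, t)) := by
    have : Measurable (fun x => |f' x|) := by simpa using hf'm.norm
    exact (this.pow (hp.comp measurable_fst)).ennreal_ofReal.lintegral_prod_left'
  let A : Set β := {t | vModular μ p (fun x => f' (x, t)) < ⊤}
  have hA : MeasurableSet A := hM measurableSet_Iio
  let g : α × β → ℝ := fun z => A.indicator 1 z.2 * mz (p z.1) (f' z)
  have hg : Measurable g :=
    ((measurable_const.indicator hA).comp measurable_snd).mul
      (measurable_mz (hp.comp measurable_fst) hf'm)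
  have hgi : ∀ t, Integrable (fun x => g (x, t)) μ := by
    intro t
    by_cases ht : t ∈ A
    · refine ⟨(hg.comp measurable_prodMk_right).aestronglyMeasurable, ?_⟩
      rw [hasFiniteIntegral_iff_norm]
      refine lt_of_eq_of_lt ?_ ht
      apply lintegral_congr_ae
      filter_upwards [h1] with x hx
      simp [g, ht, abs_mz hx]
    · simp [g, ht]
  let F : β → (α →₁[μ] ℝ) := fun t => (hgi t).toL1
  let _ : MeasurableSpace (α →₁[μ] ℝ) := borel _
  have : BorelSpace (α →₁[μ] ℝ) := ⟨rfl⟩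
  have : Fact ((1 : ℝ≥0∞) ≠ ⊤) := ⟨ENNReal.one_ne_top⟩
  have hF : Measurable F := by
    apply measurable_of_edist
    intro e
    have : ∀ t, edist (F t) e = ∫⁻ x, edist (g (x, t)) (e x) ∂μ := by
      intro t
      rw [L1.edist_def]
      apply lintegral_congr_ae
      filter_upwards [(hgi t).coeFn_toL1] with x hx
      simp only [F]
      rw [hx]
    simp only [this]
    have : Measurable fun z : α × β => edist (g z) (e z.1) :=
      hg.edist ((L1.measurable_coeFn e).comp measurable_fst)
    exact this.lintegral_prod_left'
  refine ⟨fun t => φ (J (F t)), hψ.measurable.comp hF, ?_⟩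
  filter_upwards [memV_ae hp hf, memV_ae hp hf', ae_swap hff'] with t ht ht' htt
  apply hcongr _ _ ht (hJ _)
  filter_upwards [htt, (hgi t).coeFn_toL1, h1] with x hx hx2 hx1
  have htA : t ∈ A := ht'.2
  simp only [J, F]
  rw [hx2, hx]
  simp only [g, Set.indicator_of_mem htA, Pi.one_apply, one_mul]
  have e := mz_ineq (f' (x,t)) (mz (p x)⁻¹ (mz (p x) (f' (x,t)))) hx1
  rw [mz_inv hx1, sub_self, abs_zero, mul_zero] at e
  have e2 : |f' (x,t) - (mz (p x)⁻¹ (mz (p x) (f' (x,t))))| = 0 := by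
    by_contra hne
    have := Real.rpow_pos_of_pos (lt_of_le_of_ne (abs_nonneg _) (Ne.symm hne)) (p x)
    linarith
  linarith [abs_eq_zero.1 e2]

end measurability

/-- lower semicontinuity of `Φ(u) = ∫_0^T φ(Pu(t)) dt` on `L^{p(x)}(Q)`:
if `u_n → u` strongly in `L^{p(x)}(Q)` and `Φ(u_n) ≤ a`, then `Φ(u) ≤ a`. -/
theorem Phi_lower_semicontinuous {N : ℕ} (Ω : Set (Fin N → ℝ)) (hΩ : MeasurableSet Ω)
    (hfin : volume Ω < ⊤) (T : ℝ) (hT : 0 < T)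
    (p : (Fin N → ℝ) → ℝ) (hp : Measurable p) (pm pp : ℝ) (h1 : 1 < pm) (hmp : pm ≤ pp)
    (hae : ∀ᵐ x ∂(volume.restrict Ω), pm ≤ p x ∧ p x ≤ pp)
    (φ : ((Fin N → ℝ) → ℝ) → ℝ≥0∞)
    (hproper : ∃ w, MemVLp (volume.restrict Ω) p w ∧ φ w ≠ ⊤)
    (hlsc : ∀ (w : (Fin N → ℝ) → ℝ) (s : ℕ → (Fin N → ℝ) → ℝ),
      MemVLp (volume.restrict Ω) p w → (∀ n, MemVLp (volume.restrict Ω) p (s n)) →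
      Tendsto (fun n => luxNorm (volume.restrict Ω) p fun x => s n x - w x) atTop (𝓝 0) →
      φ w ≤ atTop.liminf fun n => φ (s n))
    (hphiconv : ∀ w v, MemVLp (volume.restrict Ω) p w → MemVLp (volume.restrict Ω) p v →
      ∀ t : ℝ, 0 ≤ t → t ≤ 1 →
      φ (fun x => t * w x + (1 - t) * v x) ≤
        ENNReal.ofReal t * φ w + ENNReal.ofReal (1 - t) * φ v)
    (a : ℝ≥0∞) (u : (Fin N → ℝ) × ℝ → ℝ) (s : ℕ → (Fin N → ℝ) × ℝ → ℝ)
    (hu : MemVLp (QTmeas Ω T) (fun z => p z.1) u)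
    (hs : ∀ n, MemVLp (QTmeas Ω T) (fun z => p z.1) (s n))
    (hconv : Tendsto (fun n => luxNorm (QTmeas Ω T) (fun z => p z.1)
      fun z => s n z - u z) atTop (𝓝 0))
    (hbd : ∀ n, (∫⁻ t in Set.Ioo (0:ℝ) T, φ fun x => s n (x, t)) ≤ a) :
    (∫⁻ t in Set.Ioo (0:ℝ) T, φ fun x => u (x, t)) ≤ a := by
  have hae1 : ∀ᵐ x ∂(volume.restrict Ω), 1 ≤ p x := by
    filter_upwards [hae] with x hx
    linarith [hx.1]
  have hae2 : ∀ᵐ x ∂(volume.restrict Ω), p x ≤ pp := by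
    filter_upwards [hae] with x hx using hx.2
  unfold QTmeas at hu hs hconv
  set μ := (volume.restrict Ω : Measure (Fin N → ℝ)) with hμ
  set ν := (volume.restrict (Set.Ioo (0:ℝ) T)) with hν
  have hQ1 : ∀ᵐ z ∂(μ.prod ν), 1 ≤ p z.1 := Measure.quasiMeasurePreserving_fst.ae hae1
  have hQ2 : ∀ᵐ z ∂(μ.prod ν), p z.1 ≤ pp := Measure.quasiMeasurePreserving_fst.ae hae2
  have hmod := vMod_tendsto_of_lux hQ1 _ (fun n => vMod_sub hQ1 hQ2
    (hp.comp measurable_fst).aemeasurable (hs n) hu) hconv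
  have hex : ∀ k : ℕ, ∃ n, vModular (μ.prod ν) (fun z => p z.1) (fun z => s n z - u z)
      ≤ (2⁻¹ : ℝ≥0∞) ^ k := by
    intro k
    have hk : (0 : ℝ≥0∞) < 2⁻¹ ^ k := ENNReal.pow_pos (by simp) k
    exact ((ENNReal.tendsto_nhds_zero.1 hmod) _ hk).exists
  choose ns hns using hex
  have hsum : ∀ᵐ t ∂ν, Tendsto (fun k => vModular μ p (fun x => s (ns k) (x, t) - u (x, t)))
      atTop (𝓝 0) := by
    have hm : ∀ k, AEMeasurable (fun t => vModular μ p (fun x => s (ns k) (x, t) - u (x, t))) ν := by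
      intro k
      have h0 : AEMeasurable (fun z => |s (ns k) z - u z|) (μ.prod ν) := by
        simpa using ((hs (ns k)).1.sub hu.1).norm
      have h1 : AEMeasurable (fun z => ENNReal.ofReal (|s (ns k) z - u z| ^ p z.1)) (μ.prod ν) :=
        (h0.pow (hp.comp measurable_fst).aemeasurable).ennreal_ofReal
      exact h1.prod_swap.lintegral_prod_right'
    have hfin : ∫⁻ t, ∑' k, vModular μ p (fun x => s (ns k) (x, t) - u (x, t)) ∂ν ≠ ⊤ := by
      rw [lintegral_tsum hm]
      refine ne_top_of_le_ne_top ?_ (ENNReal.tsum_le_tsum (g := fun k => (2⁻¹ : ℝ≥0∞) ^ k) ?_)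
      · rw [ENNReal.tsum_geometric]
        simp
      · intro k
        have := hns k
        rwa [vMod_prod (f := fun z => s (ns k) z - u z) hp ((hs (ns k)).1.sub hu.1)] at this
    filter_upwards [ae_lt_top' (AEMeasurable.ennreal_tsum hm) hfin] with t ht
    exact ENNReal.tendsto_atTop_zero_of_tsum_ne_top ht.ne
  have hall : ∀ᵐ t ∂ν, ∀ k, MemVLp μ p (fun x => s (ns k) (x, t)) :=
    ae_all_iff.2 fun k => memV_ae hp (hs (ns k))
  calc ∫⁻ t, φ (fun x => u (x, t)) ∂ν
      ≤ ∫⁻ t, atTop.liminf (fun k => φ (fun x => s (ns k) (x, t))) ∂ν := by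
        apply lintegral_mono_ae
        filter_upwards [hsum, hall, memV_ae hp hu] with t ht1 ht2 ht3
        exact hlsc _ _ ht3 ht2 (lux_tendsto_of_vMod hae2 _ ht1)
    _ ≤ atTop.liminf (fun k => ∫⁻ t, φ (fun x => s (ns k) (x, t)) ∂ν) :=
        lintegral_liminf_le' fun k => phi_aemeasurable hp hae1 hae2 φ hlsc (hs (ns k))
    _ ≤ a := liminf_le_of_frequently_le' (Frequently.of_forall fun k => hbd (ns k))
end
end
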